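/- arXiv:2406.18307 — 5 statements merged into one kernel-verified Lean document; each statement's English description precedes it below -/
import Mathlib

section
/- Let m ≥ 3 be odd. Then the number of pairs (α,β) ∈ 𝔽_{q^m} × 𝔽_{q^m} with W(α,β) = 2(q−1)(q^{2m−3} + q^{m−2}) equals ((q−1)²/2)·(q^{2m−2} − q^{m−1}). -/
open Finset

/-- The defining set `D = {(a,b) ≠ (0,0) : Tr(a²) = 0 and Tr(b²) = 0}`. -/
noncomputable def defSet (q : ℕ) (F : Type*) [Field F] [Fintype F] [DecidableEq F]
    [Algebra (ZMod q) F] : Finset (F × F) :=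
  Finset.univ.filter (fun p : F × F => p ≠ (0, 0) ∧
    Algebra.trace (ZMod q) F (p.1 ^ 2) = 0 ∧ Algebra.trace (ZMod q) F (p.2 ^ 2) = 0)

/-- The Lee weight `W(α,β)` of the codeword of `C_D` corresponding to `x = α + uβ`,
i.e. the Hamming weight of its Gray image. -/
noncomputable def leeW (q : ℕ) (F : Type*) [Field F] [Fintype F] [DecidableEq F]
    [Algebra (ZMod q) F] (α β : F) : ℕ :=
  ((defSet q F).filter
      (fun p => Algebra.trace (ZMod q) F (α * p.1 + β * p.2) ≠ 0)).card +
  ((defSet q F).filter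
      (fun p => Algebra.trace (ZMod q) F (β * p.1 + α * p.2) ≠ 0)).card

section FiniteField

variable {K : Type*} [Field K] [Fintype K] [DecidableEq K]

/-- The quadratic character of a finite field with complex values. -/
noncomputable def complexQuadraticChar (K : Type*) [Field K] [Fintype K] [DecidableEq K] :
    MulChar K ℂ :=
  (quadraticChar K).ringHomComp (Int.castRingHom ℂ)

lemma complexQuadraticChar_apply (a : K) :
    complexQuadraticChar K a = ((quadraticChar K a : ℤ) : ℂ) := rfl

lemma complexQuadraticChar_sq {a : K} (ha : a ≠ 0) : complexQuadraticChar K a ^ 2 = 1 := by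
  rw [complexQuadraticChar_apply]
  exact_mod_cast quadraticChar_sq_one ha

lemma gaussSum_complexQuadraticChar_mulShift (ψ : AddChar K ℂ) (a : K) (hK : ringChar K ≠ 2) :
    gaussSum (complexQuadraticChar K) (ψ.mulShift a) =
      complexQuadraticChar K a * gaussSum (complexQuadraticChar K) ψ := by
  by_cases ha : a = 0
  · subst ha
    have h1 : complexQuadraticChar K ≠ 1 :=
      (MulChar.ringHomComp_ne_one_iff Int.cast_injective).mpr (quadraticChar_ne_one hK)
    rw [MulChar.map_zero, zero_mul]
    simpa [gaussSum] using MulChar.sum_eq_zero_of_ne_one h1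
  · have h := gaussSum_mulShift (complexQuadraticChar K) ψ (Units.mk0 a ha)
    simp only [Units.val_mk0] at h
    rw [← h, ← mul_assoc, ← sq, complexQuadraticChar_sq ha, one_mul]

lemma gaussSum_complexQuadraticChar_sq {ψ : AddChar K ℂ} (hψ : ψ.IsPrimitive)
    (hK : ringChar K ≠ 2) :
    gaussSum (complexQuadraticChar K) ψ ^ 2 = complexQuadraticChar K (-1) * Fintype.card K :=
  gaussSum_sq ((MulChar.ringHomComp_ne_one_iff Int.cast_injective).mpr (quadraticChar_ne_one hK))
    ((quadraticChar_isQuadratic K).comp _) hψ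

lemma sum_comp_sq_eq_sum_quadraticChar (hK : ringChar K ≠ 2) (f : K → ℂ) :
    ∑ a, f (a ^ 2) = ∑ t, (1 + complexQuadraticChar K t) * f t := by
  rw [← Finset.sum_fiberwise (s := univ) (g := fun a : K => a ^ 2)]
  refine Finset.sum_congr rfl fun t _ => ?_
  have h := quadraticChar_card_sqrts hK t
  rw [Finset.sum_congr rfl (g := fun _ => f t)
    (fun a ha => by rw [(Finset.mem_filter.mp ha).2]), Finset.sum_const, nsmul_eq_mul]
  congr 1
  rw [complexQuadraticChar_apply, add_comm, ← Int.cast_one (R := ℂ), ← Int.cast_add, ← h]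
  simp

lemma sum_addChar_mul_sq {ψ : AddChar K ℂ} (hψ : ψ.IsPrimitive) (hK : ringChar K ≠ 2)
    {z : K} (hz : z ≠ 0) :
    ∑ a, ψ (z * a ^ 2) = complexQuadraticChar K z * gaussSum (complexQuadraticChar K) ψ := by
  rw [sum_comp_sq_eq_sum_quadraticChar hK (fun t => ψ (z * t)),
    ← gaussSum_complexQuadraticChar_mulShift ψ z hK]
  simp_rw [add_mul, one_mul, Finset.sum_add_distrib, mul_comm z]
  rw [AddChar.sum_mulShift z hψ, if_neg hz]
  simp [gaussSum, AddChar.mulShift_apply, mul_comm z]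

lemma sum_addChar_quadratic {ψ : AddChar K ℂ} (hψ : ψ.IsPrimitive) (hK : ringChar K ≠ 2)
    {z : K} (hz : z ≠ 0) (c : K) :
    ∑ a, ψ (z * a ^ 2 + c * a) = ψ (-1 / 4 * c ^ 2 * z⁻¹) *
      (complexQuadraticChar K z * gaussSum (complexQuadraticChar K) ψ) := by
  have h2 : (2 : K) ≠ 0 := Ring.two_ne_zero hK
  have h4 : (4 : K) ≠ 0 := by
    have : (4 : K) = 2 * 2 := by norm_num
    rw [this]
    exact mul_ne_zero h2 h2
  rw [← sum_addChar_mul_sq hψ hK hz, Finset.mul_sum,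
    ← Equiv.sum_comp (Equiv.subRight (c / (2 * z)))]
  refine Finset.sum_congr rfl fun a _ => ?_
  rw [← AddChar.map_add_eq_mul]
  congr 1
  simp only [Equiv.subRight_apply]
  field_simp
  ring

lemma sum_complexQuadraticChar_mul_addChar_inv (ψ : AddChar K ℂ) (hK : ringChar K ≠ 2) (t : K) :
    ∑ z, complexQuadraticChar K z * ψ (t * z⁻¹) =
      complexQuadraticChar K t * gaussSum (complexQuadraticChar K) ψ := by
  rw [← gaussSum_complexQuadraticChar_mulShift ψ t hK, gaussSum,
    ← Equiv.sum_comp (Equiv.inv K)]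
  refine Finset.sum_congr rfl fun z _ => ?_
  simp only [Equiv.inv_apply, inv_inv, AddChar.mulShift_apply]
  congr 1
  by_cases hz : z = 0
  · simp [hz]
  have h1 : complexQuadraticChar K z * complexQuadraticChar K z⁻¹ = 1 := by
    rw [← map_mul, mul_inv_cancel₀ hz, map_one]
  have h2 := complexQuadraticChar_sq hz
  calc complexQuadraticChar K z⁻¹
      = complexQuadraticChar K z ^ 2 * complexQuadraticChar K z⁻¹ := by rw [h2, one_mul]
    _ = complexQuadraticChar K z * (complexQuadraticChar K z * complexQuadraticChar K z⁻¹) := by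
        ring
    _ = _ := by rw [h1, mul_one]

end FiniteField

section OddDegree

variable {q m : ℕ} [Fact q.Prime] {F : Type*} [Field F] [Algebra (ZMod q) F]

lemma ringChar_ne_two_of_algebra_zmod {K : Type*} [Field K] [Algebra (ZMod q) K] (hq : Odd q) :
    ringChar K ≠ 2 := by
  have : CharP K q := charP_of_injective_algebraMap (algebraMap (ZMod q) K).injective q
  rw [ringChar.eq K q]
  rintro rfl
  exact absurd hq (by decide)

lemma complexQuadraticChar_algebraMap [Fintype F] [DecidableEq F] (hq : Odd q) (hm : Odd m)
    (hF : Fintype.card F = q ^ m) (z : ZMod q) :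
    complexQuadraticChar F (algebraMap (ZMod q) F z) = complexQuadraticChar (ZMod q) z := by
  have hF2 : ringChar F ≠ 2 := ringChar_ne_two_of_algebra_zmod hq
  have hZ2 : ringChar (ZMod q) ≠ 2 := ringChar_ne_two_of_algebra_zmod hq
  by_cases hz : z = 0
  · rw [hz, _root_.map_zero, MulChar.map_zero, MulChar.map_zero]
  have hz' : algebraMap (ZMod q) F z ≠ 0 := by simpa using hz
  rw [complexQuadraticChar_apply, complexQuadraticChar_apply]
  congr 1
  have h1 := quadraticChar_eq_pow_of_char_ne_two' hF2 (algebraMap (ZMod q) F z)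
  have h2 := congrArg (algebraMap (ZMod q) F) (quadraticChar_eq_pow_of_char_ne_two' hZ2 z)
  rw [map_intCast, map_pow, ZMod.card] at h2
  have hqm : q ^ m / 2 = q / 2 * ∑ i ∈ range m, q ^ i := by
    obtain ⟨k, rfl⟩ := hq
    have hg := geom_sum_mul_add (2 * k) m
    have h3 : (2 * k + 1) / 2 = k := by omega
    rw [h3, ← hg, mul_comm k]
    generalize ∑ i ∈ range m, (2 * k + 1) ^ i = S
    have h5 : S * (2 * k) = 2 * (S * k) := by ring
    omega
  have hodd : Odd (∑ i ∈ range m, q ^ i) := by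
    rw [Finset.odd_sum_iff_odd_card_odd]
    simpa [hq.pow] using hm
  rw [hF, hqm, pow_mul, ← h2] at h1
  rcases quadraticChar_dichotomy hz with h | h <;>
  rcases quadraticChar_dichotomy hz' with h' | h' <;>
  rw [h, h'] at h1 ⊢ <;> exfalso <;> simp [hodd.neg_one_pow] at h1
  · exact Ring.neg_one_ne_one_of_char_ne_two hF2 h1
  · exact Ring.neg_one_ne_one_of_char_ne_two hF2 h1.symm

/-- The character sum `∑ ψ(Tr(γ a))` over the zeros `a` of the quadratic form `Tr(a²)`. -/
noncomputable def quadricCharSum (q : ℕ) [NeZero q] (F : Type*) [Field F] [Fintype F]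
    [Algebra (ZMod q) F] (c : F) : ℂ :=
  ∑ a : F with Algebra.trace (ZMod q) F (a ^ 2) = 0,
    ZMod.stdAddChar (Algebra.trace (ZMod q) F (c * a))

/-- The quadratic character of `Tr(γ²)`. -/
noncomputable def traceSqChar (q : ℕ) [Fact q.Prime] (F : Type*) [Field F]
    [Algebra (ZMod q) F] (c : F) : ℤ :=
  quadraticChar (ZMod q) (Algebra.trace (ZMod q) F (c ^ 2))

variable (q F) in
/-- The standard additive character composed with the trace. -/
noncomputable def traceAddChar : AddChar F ℂ :=
  (ZMod.stdAddChar (N := q)).compAddMonoidHom (Algebra.trace (ZMod q) F).toAddMonoidHom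


lemma traceAddChar_apply (a : F) :
    traceAddChar q F a = ZMod.stdAddChar (Algebra.trace (ZMod q) F a) := rfl

lemma isPrimitive_traceAddChar [Fintype F] : (traceAddChar q F).IsPrimitive := by
  refine AddChar.IsPrimitive.of_ne_one fun h => ?_
  obtain ⟨a, ha⟩ := Algebra.trace_surjective (ZMod q) F 1
  have h1 : ZMod.stdAddChar (1 : ZMod q) = (1 : ℂ) := by
    rw [← ha, ← traceAddChar_apply, h, AddChar.one_apply]
  have h2 := ZMod.isPrimitive_stdAddChar q one_ne_zero
  refine h2 ?_
  ext x
  have : x = (x.val : ℕ) • (1 : ZMod q) := by simp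
  rw [AddChar.mulShift_apply, one_mul, this, AddChar.map_nsmul_eq_pow, h1]
  simp

lemma card_mul_quadricCharSum [Fintype F] (c : F) :
    q * quadricCharSum q F c =
      ∑ z : ZMod q, ∑ a : F, traceAddChar q F (algebraMap (ZMod q) F z * a ^ 2 + c * a) := by
  rw [Finset.sum_comm, quadricCharSum, Finset.sum_filter, Finset.mul_sum]
  refine Finset.sum_congr rfl fun a _ => ?_
  simp_rw [AddChar.map_add_eq_mul, ← Finset.sum_mul, traceAddChar_apply, ← Algebra.smul_def,
    map_smul, smul_eq_mul]
  rw [AddChar.sum_mulShift _ (ZMod.isPrimitive_stdAddChar q), ZMod.card]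
  split_ifs <;> simp

lemma exists_quadricCharSum_eq [Fintype F] [DecidableEq F] (hq : Odd q) (hm : Odd m) (hF : Fintype.card F = q ^ m) :
    ∃ d : ℂ, d ^ 2 = (q : ℂ) ^ (m - 1) ∧ ∀ c, quadricCharSum q F c =
      (if c = 0 then (q : ℂ) ^ (m - 1) else 0) + d * traceSqChar q F c := by
  have hF2 : ringChar F ≠ 2 := ringChar_ne_two_of_algebra_zmod hq
  have hZ2 : ringChar (ZMod q) ≠ 2 := ringChar_ne_two_of_algebra_zmod hq
  have hq0 : (q : ℂ) ≠ 0 := by exact_mod_cast (Fact.out : q.Prime).ne_zero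
  have hψ : (traceAddChar q F).IsPrimitive := isPrimitive_traceAddChar
  have h4 : (-1 / 4 : ZMod q) ≠ 0 := by
    have h2 : (2 : ZMod q) ≠ 0 := Ring.two_ne_zero hZ2
    have : (4 : ZMod q) = 2 * 2 := by norm_num
    rw [this]
    exact div_ne_zero (neg_ne_zero.mpr one_ne_zero) (mul_ne_zero h2 h2)
  set G := gaussSum (complexQuadraticChar F) (traceAddChar q F) with hG
  set G₀ := gaussSum (complexQuadraticChar (ZMod q)) (ZMod.stdAddChar (N := q)) with hG₀
  obtain ⟨n, rfl⟩ : ∃ n, m = n + 1 := ⟨m - 1, by have := hm.pos; omega⟩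
  refine ⟨G * G₀ * complexQuadraticChar (ZMod q) (-1 / 4) / q, ?_, fun c => ?_⟩
  · have h1 : complexQuadraticChar F (-1) = complexQuadraticChar (ZMod q) (-1) := by
      rw [← complexQuadraticChar_algebraMap hq hm hF, _root_.map_neg (algebraMap (ZMod q) F),
        _root_.map_one (algebraMap (ZMod q) F)]
    rw [div_pow, mul_pow, mul_pow, complexQuadraticChar_sq h4, hG, hG₀,
      gaussSum_complexQuadraticChar_sq hψ hF2,
      gaussSum_complexQuadraticChar_sq (ZMod.isPrimitive_stdAddChar q) hZ2, h1, hF, ZMod.card]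
    have h2 := complexQuadraticChar_sq (K := ZMod q) (neg_ne_zero.mpr one_ne_zero)
    push_cast
    field_simp
    linear_combination (q : ℂ) ^ (n + 1) * h2
  · have key : ∀ z : ZMod q,
        ∑ a : F, traceAddChar q F (algebraMap (ZMod q) F z * a ^ 2 + c * a) =
        (if z = 0 then (if c = 0 then (q : ℂ) ^ (n + 1) else 0) else 0) +
        G * (complexQuadraticChar (ZMod q) z * ZMod.stdAddChar
          ((-1 / 4 * Algebra.trace (ZMod q) F (c ^ 2)) * z⁻¹)) := by
      intro z
      by_cases hz : z = 0
      · subst hz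
        rw [MulChar.map_zero]
        simp only [_root_.map_zero, zero_mul, zero_add, mul_comm c]
        rw [AddChar.sum_mulShift c hψ, hF]
        simp
      · have hz' : algebraMap (ZMod q) F z ≠ 0 := by simpa using hz
        rw [sum_addChar_quadratic hψ hF2 hz', complexQuadraticChar_algebraMap hq hm hF,
          if_neg hz, traceAddChar_apply]
        have : (-1 / 4 * c ^ 2 * (algebraMap (ZMod q) F z)⁻¹ : F) =
            (-1 / 4 * z⁻¹ : ZMod q) • c ^ 2 := by
          rw [Algebra.smul_def]
          simp only [map_mul, map_div₀, map_neg, map_one, map_inv₀, map_ofNat]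
          ring
        rw [this, map_smul, smul_eq_mul]
        have h5 : (-1 / 4 * z⁻¹ * Algebra.trace (ZMod q) F (c ^ 2)) =
          (-1 / 4 * Algebra.trace (ZMod q) F (c ^ 2)) * z⁻¹ := by ring
        rw [h5]
        ring
    have h := card_mul_quadricCharSum (q := q) c
    simp_rw [key] at h
    rw [Finset.sum_add_distrib, ← Finset.mul_sum,
      sum_complexQuadraticChar_mul_addChar_inv _ hZ2, map_mul, Finset.sum_ite_eq',
      if_pos (mem_univ _)] at h
    rw [← mul_right_inj' hq0, h, traceSqChar, ← complexQuadraticChar_apply, Nat.add_sub_cancel]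
    split_ifs <;> field_simp <;> ring

lemma traceSqChar_zero : traceSqChar q F 0 = 0 := by
  simp [traceSqChar, MulChar.map_zero]

lemma traceSqChar_algebraMap_mul {y : ZMod q} (hy : y ≠ 0) (c : F) :
    traceSqChar q F (algebraMap (ZMod q) F y * c) = traceSqChar q F c := by
  rw [traceSqChar, mul_pow, ← map_pow, ← Algebra.smul_def, map_smul, smul_eq_mul, map_mul,
    quadraticChar_sq_one' hy, one_mul, traceSqChar]

lemma quadricCharSum_zero [Fintype F] : quadricCharSum q F 0 =
    #{a : F | Algebra.trace (ZMod q) F (a ^ 2) = 0} := by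
  simp [quadricCharSum]

lemma sum_quadricCharSum [Fintype F] [DecidableEq F] : ∑ c, quadricCharSum q F c = Fintype.card F := by
  simp_rw [quadricCharSum]
  rw [Finset.sum_comm]
  simp_rw [← traceAddChar_apply, AddChar.sum_mulShift _ isPrimitive_traceAddChar]
  rw [Finset.sum_filter, Finset.sum_eq_single 0] <;> simp +contextual

lemma filter_defSet_trace_ne_zero [Fintype F] [DecidableEq F] (α β : F) :
    {p ∈ defSet q F | Algebra.trace (ZMod q) F (α * p.1 + β * p.2) ≠ 0} =
      {p ∈ ({a | Algebra.trace (ZMod q) F (a ^ 2) = 0} : Finset F) ×ˢ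
        ({a | Algebra.trace (ZMod q) F (a ^ 2) = 0} : Finset F) |
          Algebra.trace (ZMod q) F (α * p.1 + β * p.2) ≠ 0} := by
  ext p
  simp only [defSet, mem_filter, mem_univ, true_and, mem_product]
  constructor
  · rintro ⟨⟨-, h1⟩, h2⟩
    exact ⟨h1, h2⟩
  · rintro ⟨h1, h2⟩
    refine ⟨⟨?_, h1⟩, h2⟩
    rintro rfl
    simp at h2

lemma card_mul_card_filter_defSet [Fintype F] [DecidableEq F] (α β : F) :
    (q : ℂ) * #{p ∈ defSet q F | Algebra.trace (ZMod q) F (α * p.1 + β * p.2) ≠ 0} =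
      q * quadricCharSum q F 0 ^ 2 -
        ∑ y : ZMod q, quadricCharSum q F (algebraMap (ZMod q) F y * α) *
          quadricCharSum q F (algebraMap (ZMod q) F y * β) := by
  rw [filter_defSet_trace_ne_zero, quadricCharSum_zero]
  simp_rw [quadricCharSum, Finset.sum_mul_sum, ← Finset.sum_product', ← AddChar.map_add_eq_mul,
    ← map_add, mul_assoc, ← mul_add, ← Algebra.smul_def, map_smul, smul_eq_mul]
  rw [Finset.sum_product_right]
  simp_rw [AddChar.sum_mulShift _ (ZMod.isPrimitive_stdAddChar q), ZMod.card]
  set S : Finset F := {a | Algebra.trace (ZMod q) F (a ^ 2) = 0}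
  have h := Finset.card_filter_add_card_filter_not (s := S ×ˢ S)
    (fun p => Algebra.trace (ZMod q) F (α * p.1 + β * p.2) = 0)
  rw [Finset.card_product] at h
  have h' := congrArg (Nat.cast : ℕ → ℂ) h
  push_cast at h'
  simp_rw [sq, ← h', Nat.cast_ite, Nat.cast_zero, ← Finset.sum_filter, Finset.sum_const,
    nsmul_eq_mul]
  ring

lemma card_mul_leeW [Fintype F] [DecidableEq F] (hq : Odd q) (hm : Odd m)
    (hF : Fintype.card F = q ^ m) (α β : F) :
    (q : ℂ) * leeW q F α β = 2 * (q - 1) *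
      (quadricCharSum q F 0 ^ 2 - quadricCharSum q F α * quadricCharSum q F β) := by
  obtain ⟨d, -, hd⟩ := exists_quadricCharSum_eq (F := F) hq hm hF
  have hscale : ∀ y : ZMod q, y ≠ 0 → ∀ c,
      quadricCharSum q F (algebraMap (ZMod q) F y * c) = quadricCharSum q F c := by
    intro y hy c
    have hy' : algebraMap (ZMod q) F y ≠ 0 := by simpa using hy
    rw [hd, hd, traceSqChar_algebraMap_mul hy]
    simp [hy']
  have hsum : ∀ α β : F, ∑ y : ZMod q, quadricCharSum q F (algebraMap (ZMod q) F y * α) *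
      quadricCharSum q F (algebraMap (ZMod q) F y * β) = quadricCharSum q F 0 ^ 2 +
        (q - 1) * (quadricCharSum q F α * quadricCharSum q F β) := by
    intro α β
    rw [← Finset.add_sum_erase _ _ (mem_univ 0), Finset.sum_congr rfl
      (g := fun _ => quadricCharSum q F α * quadricCharSum q F β)
      (fun y hy => by rw [hscale y (ne_of_mem_erase hy), hscale y (ne_of_mem_erase hy)]),
      Finset.sum_const, card_erase_of_mem (mem_univ _), Finset.card_univ, ZMod.card,
      nsmul_eq_mul, Nat.cast_sub (Fact.out : q.Prime).one_le]
    simp [sq]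
  rw [leeW, Nat.cast_add, mul_add, card_mul_card_filter_defSet, card_mul_card_filter_defSet,
    hsum, hsum]
  ring

lemma traceSqChar_trichotomy (c : F) :
    traceSqChar q F c = 0 ∨ traceSqChar q F c = 1 ∨ traceSqChar q F c = -1 :=
  quadraticChar_isQuadratic _ _

lemma leeW_eq_iff [Fintype F] [DecidableEq F] {n : ℕ} (hq : Odd q) (hn : Odd (n + 3))
    (hF : Fintype.card F = q ^ (n + 3)) (α β : F) :
    (leeW q F α β : ℤ) = 2 * ((q : ℤ) - 1) * ((q : ℤ) ^ (2 * n + 3) + (q : ℤ) ^ (n + 1)) ↔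
      traceSqChar q F α * traceSqChar q F β = -1 := by
  obtain ⟨d, hd2, hd⟩ := exists_quadricCharSum_eq (F := F) hq hn hF
  have hq1 : 1 < q := (Fact.out : q.Prime).one_lt
  have hq0 : (q : ℂ) ≠ 0 := by exact_mod_cast (by omega : q ≠ 0)
  have hq1' : (q : ℂ) - 1 ≠ 0 := by
    rw [sub_ne_zero]
    exact_mod_cast (by omega : q ≠ 1)
  have hQ : (q : ℂ) ^ (n + 2) ≠ 0 := pow_ne_zero _ hq0
  have hw := card_mul_leeW hq hn hF α β
  have hT0 : quadricCharSum q F 0 = (q : ℂ) ^ (n + 2) := by simp [hd, traceSqChar_zero]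
  have h1 : (leeW q F α β : ℤ) =
      2 * ((q : ℤ) - 1) * ((q : ℤ) ^ (2 * n + 3) + (q : ℤ) ^ (n + 1)) ↔
      quadricCharSum q F α * quadricCharSum q F β = -(q : ℂ) ^ (n + 2) := by
    rw [← Int.cast_inj (α := ℂ), ← mul_right_inj' hq0]
    push_cast
    rw [hw, hT0]
    have h2 : (q : ℂ) * (2 * (q - 1) * (q ^ (2 * n + 3) + q ^ (n + 1))) =
      2 * (q - 1) * ((q ^ (n + 2)) ^ 2 - -q ^ (n + 2)) := by ring
    rw [h2, mul_right_inj' (mul_ne_zero two_ne_zero hq1'), sub_right_inj]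
  have hne : ∀ c, d * (traceSqChar q F c : ℂ) ≠ -1 := by
    intro c hc
    have h2 : d ^ 2 * (traceSqChar q F c : ℂ) ^ 2 = 1 := by
      rw [← mul_pow, hc]
      norm_num
    have h3 : (1 : ℂ) ≠ q ^ (n + 2) := by
      exact_mod_cast (Nat.one_lt_pow (by omega) hq1).ne
    rw [hd2] at h2
    rcases traceSqChar_trichotomy (q := q) c with h | h | h <;> rw [h] at h2
    · simp at h2
    · push_cast at h2
      exact h3 (by linear_combination (-1 : ℂ) * h2)
    · push_cast at h2
      exact h3 (by linear_combination (-1 : ℂ) * h2)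
  rw [h1]
  by_cases hα : α = 0
  · subst hα
    rw [hT0, traceSqChar_zero, zero_mul, ← mul_neg_one, mul_right_inj' hQ]
    refine iff_of_false ?_ (by norm_num)
    by_cases hβ : β = 0
    · subst hβ
      rw [hT0]
      intro h
      have : (q ^ (n + 2) : ℤ) = -1 := by exact_mod_cast h
      have : (0 : ℤ) ≤ q ^ (n + 2) := by positivity
      omega
    · rw [hd, if_neg hβ, zero_add]
      exact hne β
  by_cases hβ : β = 0
  · subst hβ
    rw [hT0, traceSqChar_zero, mul_zero, mul_comm, ← mul_neg_one, mul_right_inj' hQ, hd,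
      if_neg hα, zero_add]
    exact iff_of_false (hne α) (by norm_num)
  rw [hd, hd, if_neg hα, if_neg hβ, zero_add, zero_add, mul_mul_mul_comm, ← sq, hd2,
    ← mul_neg_one]
  simp only [Nat.add_succ_sub_one]
  rw [mul_right_inj' hQ]
  exact_mod_cast Iff.rfl

lemma two_mul_card_traceSqChar_mul_eq_neg_one [Fintype F] :
    2 * (#{p : F × F | traceSqChar q F p.1 * traceSqChar q F p.2 = -1} : ℤ) =
      (∑ c : F, traceSqChar q F c ^ 2) ^ 2 - (∑ c : F, traceSqChar q F c) ^ 2 := by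
  rw [sq (∑ c, _), sq (∑ c, _), Finset.sum_mul_sum, Finset.sum_mul_sum, ← Fintype.sum_prod_type',
    ← Fintype.sum_prod_type', ← Finset.sum_sub_distrib, Finset.card_filter, Nat.cast_sum,
    Finset.mul_sum]
  refine Finset.sum_congr rfl fun p _ => ?_
  rcases traceSqChar_trichotomy (q := q) p.1 with h | h | h <;>
  rcases traceSqChar_trichotomy (q := q) p.2 with h' | h' | h' <;> simp [h, h']

lemma sum_traceSqChar_sq [Fintype F] :
    ∑ c : F, traceSqChar q F c ^ 2 =
      Fintype.card F - (#{a : F | Algebra.trace (ZMod q) F (a ^ 2) = 0} : ℤ) := by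
  have h : ∀ c : F, traceSqChar q F c ^ 2 =
      1 - if Algebra.trace (ZMod q) F (c ^ 2) = 0 then 1 else 0 := by
    intro c
    split_ifs with hc
    · rw [traceSqChar, hc, quadraticChar_zero]
      norm_num
    · rw [traceSqChar, quadraticChar_sq_one hc, sub_zero]
  simp_rw [h, Finset.sum_sub_distrib]
  simp

end OddDegree

theorem stmt12 (q m : ℕ) [Fact q.Prime] (hq : Odd q) (hm : 3 ≤ m) (hmodd : Odd m)
    (F : Type*) [Field F] [Fintype F] [DecidableEq F] [Algebra (ZMod q) F]
    (hF : Fintype.card F = q ^ m) :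
    2 * ((Finset.univ.filter (fun p : F × F => (leeW q F p.1 p.2 : ℤ) =
        2 * ((q : ℤ) - 1) * ((q : ℤ) ^ (2 * m - 3) + (q : ℤ) ^ (m - 2)))).card : ℤ) =
      ((q : ℤ) - 1) ^ 2 * ((q : ℤ) ^ (2 * m - 2) - (q : ℤ) ^ (m - 1)) := by
  obtain ⟨n, rfl⟩ : ∃ n, m = n + 3 := ⟨m - 3, by omega⟩
  have e1 : 2 * (n + 3) - 3 = 2 * n + 3 := by omega
  have e2 : n + 3 - 2 = n + 1 := by omega
  have e3 : 2 * (n + 3) - 2 = 2 * n + 4 := by omega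
  have e4 : n + 3 - 1 = n + 2 := by omega
  simp_rw [e1, e2, e3, e4, leeW_eq_iff hq hmodd hF]
  rw [two_mul_card_traceSqChar_mul_eq_neg_one, sum_traceSqChar_sq, hF]
  obtain ⟨d, hd2, hd⟩ := exists_quadricCharSum_eq (F := F) hq hmodd hF
  rw [e4] at hd2 hd
  have hS : (#{a : F | Algebra.trace (ZMod q) F (a ^ 2) = 0} : ℂ) = (q : ℂ) ^ (n + 2) := by
    rw [← quadricCharSum_zero, hd, traceSqChar_zero]
    simp
  have hS' : #{a : F | Algebra.trace (ZMod q) F (a ^ 2) = 0} = q ^ (n + 2) := by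
    exact_mod_cast hS
  have hsum : (q : ℂ) ^ (n + 2) + d * ((∑ c : F, traceSqChar q F c : ℤ) : ℂ) = q ^ (n + 3) := by
    have h := sum_quadricCharSum (q := q) (F := F)
    simp_rw [hd] at h
    rw [Finset.sum_add_distrib, ← Finset.mul_sum, hF] at h
    simpa using h
  have hq0 : (q : ℂ) ≠ 0 := by exact_mod_cast (Fact.out : q.Prime).ne_zero
  have hsq : ((∑ c : F, traceSqChar q F c : ℤ) : ℂ) ^ 2 = (q - 1) ^ 2 * q ^ (n + 2) := by
    have h : d * ((∑ c : F, traceSqChar q F c : ℤ) : ℂ) = (q - 1) * q ^ (n + 2) := by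
      linear_combination hsum
    rw [← mul_right_inj' (pow_ne_zero (n + 2) hq0), ← hd2, ← mul_pow, h, hd2]
    ring
  have hsq' : (∑ c : F, traceSqChar q F c) ^ 2 = ((q : ℤ) - 1) ^ 2 * q ^ (n + 2) := by
    exact_mod_cast hsq
  rw [hsq', hS']
  push_cast
  ring
end

section
/- Let m ≥ 2 be even and let S = {(α,β) ∈ 𝔽_{q^m} × 𝔽_{q^m} : exactly one of α, β is zero, and the nonzero member γ of the pair satisfies Tr(γ²) = 0}. Then #S = 2(q^{m−1} + ε(q−1)q^{(m−2)/2} − 1), and every (α,β) ∈ S satisfies W(α,β) = 2(q−1)q^{2m−3} + 2ε(q−1)²q^{(3m−6)/2} (an equality of integers, with ε = ±1 as defined). -/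
open Finset

/-- For even `m`, the sign `ε = −(−1)^{((q−1)²m)/8}`, so that the quadratic Gauss sum
over `𝔽_{q^m}` equals `ε·q^{m/2}`. -/
def epsEven (q m : ℕ) : ℤ := -(-1 : ℤ) ^ ((q - 1) ^ 2 * m / 8)

/-- The fibre over `y` of the `d`-th power map on a finite cyclic group of order divisible by `d`. -/
theorem IsCyclic.card_filter_pow_eq {G : Type*} [CommGroup G] [IsCyclic G] [Fintype G]
    [DecidableEq G] {d : ℕ} (hd : d ∣ Fintype.card G) {y : G} (hy : ∃ g : G, g ^ d = y) :
    #{g : G | g ^ d = y} = d := by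
  have hker := IsCyclic.card_powMonoidHom_ker G d
  rw [Nat.card_eq_fintype_card (α := G), Nat.gcd_eq_right hd] at hker
  have hfib := MonoidHom.card_fiber_eq_of_mem_range (powMonoidHom d : G →* G)
    (x := y) (y := 1) hy ⟨1, by simp⟩
  simp only [powMonoidHom_apply] at hfib
  rw [hfib]
  conv_rhs => rw [← hker]
  rw [← Fintype.card_subtype, ← Nat.card_eq_fintype_card]
  rfl

/-- A surjective linear functional over `ZMod q` takes every value equally often. -/
theorem card_filter_eq_mul_of_surjective {q : ℕ} [NeZero q] {V : Type*} [AddCommGroup V]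
    [Fintype V] [Module (ZMod q) V] (f : V →ₗ[ZMod q] ZMod q) (hf : Function.Surjective f)
    (c : ZMod q) : #{v : V | f v = c} * q = Fintype.card V := by
  classical
  have h := Finset.card_eq_sum_card_fiberwise (s := (univ : Finset V)) (t := univ) (f := f)
    (fun _ _ => by simp)
  rw [Finset.sum_congr rfl fun b _ =>
    AddMonoidHom.card_fiber_eq_of_mem_range f (x := b) (y := c) (hf b) (hf c)] at h
  simpa [ZMod.card, mul_comm] using h.symm

section QuadraticExtension

variable {K F : Type*} [Field K] [Fintype K] [Field F] [Fintype F] [Algebra K F]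

theorem trace_sq_eq_zero_iff (hfin : Module.finrank K F = 2) {a : F} (ha : a ≠ 0) :
    Algebra.trace K F (a ^ 2) = 0 ↔ a ^ (2 * (Fintype.card K - 1)) = -1 := by
  have hpos : 0 < Fintype.card K := Fintype.card_pos
  rw [← (algebraMap K F).injective.eq_iff, map_zero, FiniteField.algebraMap_trace_eq_sum_pow, hfin,
    Nat.card_eq_fintype_card]
  have h : (a ^ 2) ^ Fintype.card K = a ^ 2 * a ^ (2 * (Fintype.card K - 1)) := by
    rw [← pow_mul, ← pow_add]
    congr 1
    omega
  simp only [sum_range_succ, range_zero, sum_empty, pow_zero, pow_one, zero_add, h]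
  rw [show a ^ 2 + a ^ 2 * a ^ (2 * (Fintype.card K - 1))
    = a ^ 2 * (a ^ (2 * (Fintype.card K - 1)) + 1) by ring, mul_eq_zero]
  simp [ha, eq_neg_iff_add_eq_zero]

theorem card_eq_sq_of_finrank_eq_two (hfin : Module.finrank K F = 2) :
    Fintype.card F = Fintype.card K ^ 2 := by
  rw [Module.card_eq_pow_finrank (K := K) (V := F), hfin]

theorem card_trace_sq_eq_zero [DecidableEq K] (hfin : Module.finrank K F = 2) {ε : ℤ}
    (hε : (ε = 1 ∧ Fintype.card K % 4 = 3) ∨ (ε = -1 ∧ Fintype.card K % 4 = 1)) :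
    (#{a : F | Algebra.trace K F (a ^ 2) = 0} : ℤ) = 1 + (1 + ε) * (Fintype.card K - 1) := by
  classical
  have hcF := card_eq_sq_of_finrank_eq_two hfin
  have hQ1 : 1 < Fintype.card K := Fintype.one_lt_card
  have hodd : Fintype.card F % 2 = 1 := by
    rw [hcF, Nat.pow_mod]
    rcases hε with h | h
    · rw [show Fintype.card K % 2 = 1 by omega]
    · rw [show Fintype.card K % 2 = 1 by omega]
  have hneg : (-1 : F) ≠ 1 := by
    intro h
    have h2 : ringChar F = 2 := by
      by_contra h2
      exact Ring.neg_one_ne_one_of_char_ne_two h2 h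
    have := FiniteField.even_card_of_char_two h2
    omega
  set Q := Fintype.card K with hQ
  have hunits : #{a : F | Algebra.trace K F (a ^ 2) = 0}
      = 1 + #{u : Fˣ | u ^ (2 * (Q - 1)) = -1} := by
    have : ({a : F | Algebra.trace K F (a ^ 2) = 0} : Finset F)
        = insert 0 (({u : Fˣ | u ^ (2 * (Q - 1)) = -1} : Finset Fˣ).map
          ⟨Units.val, Units.val_injective⟩) := by
      ext a
      by_cases ha : a = 0
      · simp [ha]
      · simp only [mem_filter, mem_univ, true_and, trace_sq_eq_zero_iff hfin ha, mem_insert, ha,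
          false_or, mem_map, Function.Embedding.coeFn_mk]
        constructor
        · intro h
          exact ⟨Units.mk0 a ha, Units.ext (by simpa using h), rfl⟩
        · rintro ⟨u, hu, rfl⟩
          simpa using congrArg Units.val hu
    rw [this, card_insert_of_notMem (by simp), card_map, add_comm]
  rw [hunits]
  have hcU : Fintype.card Fˣ = (Q - 1) * (Q + 1) := by
    rw [Fintype.card_units, hcF, mul_comm, ← Nat.sq_sub_sq, one_pow]
  rcases hε with ⟨rfl, h⟩ | ⟨rfl, h⟩
  · obtain ⟨r, hr⟩ : ∃ r, Q + 1 = 4 * r := ⟨(Q + 1) / 4, by omega⟩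
    rw [IsCyclic.card_filter_pow_eq]
    · push_cast [hQ1.le]
      ring
    · exact ⟨2 * r, by rw [hcU, hr]; ring⟩
    · obtain ⟨g, hg⟩ := IsCyclic.exists_ofOrder_eq_natCard (α := Fˣ)
      rw [Nat.card_eq_fintype_card, hcU, hr] at hg
      refine ⟨g ^ r, ?_⟩
      have hsq : ((g ^ r) ^ (2 * (Q - 1))) ^ 2 = 1 := by
        rw [← pow_mul, ← pow_mul, show r * (2 * (Q - 1) * 2) = (Q - 1) * (4 * r) by ring, ← hg,
          pow_orderOf_eq_one]
      have hne : (g ^ r) ^ (2 * (Q - 1)) ≠ 1 := by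
        rw [← pow_mul]
        apply pow_ne_one_of_lt_orderOf
        · have : 0 < r := by omega
          have : 0 < Q - 1 := by omega
          positivity
        · have : 0 < r * (Q - 1) := Nat.mul_pos (by omega) (by omega)
          rw [hg]
          nlinarith
      have hsq' := congrArg Units.val hsq
      rw [Units.val_pow_eq_pow_val, Units.val_one, sq_eq_one_iff] at hsq'
      rcases hsq' with h1 | h1
      · exact absurd (Units.ext h1) hne
      · exact Units.ext (by simpa using h1)
  · obtain ⟨r, hr⟩ : ∃ r, Q + 1 = 2 * (2 * r + 1) := ⟨(Q - 1) / 4, by omega⟩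
    rw [filter_false_of_mem]
    · simp
    · intro u _ hu
      have h1 : u ^ ((Q - 1) * (Q + 1)) = 1 := hcU ▸ pow_card_eq_one
      rw [hr, show (Q - 1) * (2 * (2 * r + 1)) = 2 * (Q - 1) * (2 * r + 1) by ring, pow_mul, hu,
        Odd.neg_one_pow ⟨r, rfl⟩] at h1
      exact hneg (by simpa using congrArg Units.val h1)

/-- In a quadratic extension of finite fields of odd order, every element of the base field is a
square. -/
theorem exists_sq_eq_algebraMap (hfin : Module.finrank K F = 2) (hodd : Odd (Fintype.card K))
    (z : K) : ∃ c : F, c ^ 2 = algebraMap K F z := by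
  by_cases hz : z = 0
  · exact ⟨0, by simp [hz]⟩
  obtain ⟨r, hr⟩ := hodd
  have hcF := card_eq_sq_of_finrank_eq_two hfin
  have hchar : ringChar F ≠ 2 := by
    intro h2
    have := FiniteField.even_card_of_char_two h2
    rw [hcF, hr, Nat.pow_mod] at this
    norm_num [Nat.add_mod] at this
  have hsq : IsSquare (algebraMap K F z) := by
    rw [FiniteField.isSquare_iff hchar (by simpa using hz), ← map_pow, hcF, hr,
      show (2 * r + 1) ^ 2 / 2 = (2 * r) * (r + 1) by
        rw [show (2 * r + 1) ^ 2 = 2 * (2 * r * (r + 1)) + 1 by ring]; omega,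
      pow_mul, show 2 * r = Fintype.card K - 1 by omega, FiniteField.pow_card_sub_one_eq_one z hz]
    simp
  obtain ⟨c, hc⟩ := hsq
  exact ⟨c, by rw [hc, sq]⟩

theorem card_trace_sq_eq_of_ne_zero [DecidableEq K] (hfin : Module.finrank K F = 2)
    (hodd : Odd (Fintype.card K)) {z w : K} (hz : z ≠ 0) (hw : w ≠ 0) :
    #{a : F | Algebra.trace K F (a ^ 2) = z} = #{a : F | Algebra.trace K F (a ^ 2) = w} := by
  obtain ⟨c, hc⟩ := exists_sq_eq_algebraMap (F := F) hfin hodd (w / z)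
  have hwz : w / z ≠ 0 := div_ne_zero hw hz
  have hc0 : c ≠ 0 := by
    rintro rfl
    have : algebraMap K F (w / z) = 0 := by rw [← hc]; simp
    exact hwz (by simpa using this)
  refine card_equiv (Equiv.mulLeft₀ c hc0) fun a => ?_
  simp only [mem_filter, mem_univ, true_and, Equiv.mulLeft₀_apply, mul_pow, hc, ← Algebra.smul_def,
    map_smul, smul_eq_mul]
  rw [div_mul_eq_mul_div, div_eq_iff hz, mul_right_inj' hw]

theorem card_trace_sq_eq [DecidableEq K] (hfin : Module.finrank K F = 2) {ε : ℤ}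
    (hε : (ε = 1 ∧ Fintype.card K % 4 = 3) ∨ (ε = -1 ∧ Fintype.card K % 4 = 1))
    {z : K} (hz : z ≠ 0) :
    (#{a : F | Algebra.trace K F (a ^ 2) = z} : ℤ) = Fintype.card K - ε := by
  have hodd : Odd (Fintype.card K) := Nat.odd_iff.mpr (by omega)
  have hQ1 : 1 < Fintype.card K := Fintype.one_lt_card
  have h := Finset.card_eq_sum_card_fiberwise (s := (univ : Finset F)) (t := univ)
    (f := fun a => Algebra.trace K F (a ^ 2)) (fun _ _ => by simp)
  rw [← add_sum_erase _ _ (mem_univ (0 : K)), Finset.sum_congr rfl fun b hb =>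
    card_trace_sq_eq_of_ne_zero hfin hodd (ne_of_mem_erase hb) hz, sum_const,
    card_erase_of_mem (mem_univ _), card_univ, card_univ, smul_eq_mul,
    card_eq_sq_of_finrank_eq_two hfin] at h
  have h' := congrArg (Nat.cast : ℕ → ℤ) h
  rw [Nat.cast_add, card_trace_sq_eq_zero hfin hε, Nat.cast_mul, Nat.cast_sub hQ1.le] at h'
  push_cast at h'
  have hQ : (Fintype.card K : ℤ) - 1 ≠ 0 := by
    have : (1 : ℤ) < Fintype.card K := by exact_mod_cast hQ1
    omega
  apply mul_left_cancel₀ hQ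
  linarith

end QuadraticExtension

theorem epsEven_two_mul {q : ℕ} (hq : Odd q) (k : ℕ) :
    (epsEven q (2 * k) = 1 ∧ q ^ k % 4 = 3) ∨ (epsEven q (2 * k) = -1 ∧ q ^ k % 4 = 1) := by
  obtain ⟨r, rfl⟩ := hq
  have he : epsEven (2 * r + 1) (2 * k) = -(-1) ^ (r ^ 2 * k) := by
    unfold epsEven
    congr 2
    rw [Nat.add_sub_cancel, show (2 * r) ^ 2 * (2 * k) = 8 * (r ^ 2 * k) by ring]
    omega
  rw [he]
  rcases Nat.even_or_odd r with hr | hr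
  · right
    refine ⟨by rw [Even.neg_one_pow]; exact (hr.pow_of_ne_zero two_ne_zero).mul_right k, ?_⟩
    obtain ⟨s, rfl⟩ := hr
    rw [Nat.pow_mod, show (2 * (s + s) + 1) % 4 = 1 by omega]
    simp
  · have h3 : (2 * r + 1) % 4 = 3 := by
      obtain ⟨s, rfl⟩ := hr
      omega
    rcases Nat.even_or_odd k with hk | hk
    · right
      refine ⟨by rw [Even.neg_one_pow]; exact hk.mul_left _, ?_⟩
      obtain ⟨s, rfl⟩ := hk
      rw [← two_mul, pow_mul, Nat.pow_mod, Nat.pow_mod (2 * r + 1), h3]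
      simp
    · left
      refine ⟨by rw [Odd.neg_one_pow (hr.pow.mul hk)]; rfl, ?_⟩
      obtain ⟨s, rfl⟩ := hk
      rw [pow_succ, pow_mul, Nat.mul_mod, Nat.pow_mod, Nat.pow_mod (2 * r + 1), h3]
      simp

/-- The number of zeros of the quadratic form `Tr(a²)` on `𝔽_{q^{2k}}`. -/
theorem card_trace_sq_eq_zero_prime_field {q k : ℕ} [Fact q.Prime] (hq : Odd q) (hk : k ≠ 0)
    {F : Type*} [Field F] [Fintype F] [Algebra (ZMod q) F] (hF : Fintype.card F = q ^ (2 * k)) :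
    (#{a : F | Algebra.trace (ZMod q) F (a ^ 2) = 0} : ℤ) =
      (q : ℤ) ^ (2 * k - 1) + epsEven q (2 * k) * ((q : ℤ) - 1) * (q : ℤ) ^ (k - 1) := by
  classical
  have hq1 : 1 < q := (Fact.out : q.Prime).one_lt
  have : Fintype (GaloisField q k) := Fintype.ofFinite _
  set K := GaloisField q k
  have hcK : Fintype.card K = q ^ k := by
    rw [← Nat.card_eq_fintype_card, GaloisField.card q k hk]
  have hfF : Module.finrank (ZMod q) F = 2 * k :=
    Nat.pow_right_injective hq1 (by simpa only [hF] using FiniteField.pow_finrank_eq_card q F)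
  have hfK : Module.finrank (ZMod q) K = k := GaloisField.finrank q hk
  obtain ⟨i⟩ : Nonempty (K →ₐ[ZMod q] F) :=
    FiniteField.nonempty_algHom_of_finrank_dvd (by rw [hfF, hfK]; exact dvd_mul_left k 2)
  let : Algebra K F := i.toRingHom.toAlgebra
  have : IsScalarTower (ZMod q) K F := IsScalarTower.of_algebraMap_eq fun x => (i.commutes x).symm
  have hfin : Module.finrank K F = 2 := by
    have h := Module.finrank_mul_finrank (ZMod q) K F
    rw [hfF, hfK, mul_comm 2] at h
    exact Nat.eq_of_mul_eq_mul_left (Nat.pos_of_ne_zero hk) h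
  have hε := epsEven_two_mul hq k
  rw [← hcK] at hε
  have hker := card_filter_eq_mul_of_surjective (Algebra.trace (ZMod q) K)
    (Algebra.trace_surjective (ZMod q) K) 0
  set Z : Finset K := {z : K | Algebra.trace (ZMod q) K z = 0} with hZ
  have hsum : #{a : F | Algebra.trace (ZMod q) F (a ^ 2) = 0}
      = ∑ z ∈ Z, #{a : F | Algebra.trace K F (a ^ 2) = z} := by
    refine Eq.trans ?_ (sum_card_fiberwise_eq_card_filter univ Z
      (fun a : F => Algebra.trace K F (a ^ 2))).symm
    simp [hZ, Algebra.trace_trace]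
  have h0 : (0 : K) ∈ Z := by simp [hZ]
  rw [hsum, Nat.cast_sum, ← add_sum_erase _ _ h0, Finset.sum_congr rfl fun z hz =>
    card_trace_sq_eq hfin hε (ne_of_mem_erase hz), card_trace_sq_eq_zero hfin hε, sum_const,
    card_erase_of_mem h0, hcK]
  obtain ⟨l, rfl⟩ : ∃ l, k = l + 1 := ⟨k - 1, by omega⟩
  have hZc : #Z = q ^ l := by
    rw [hcK, pow_succ] at hker
    exact Nat.eq_of_mul_eq_mul_right (by omega) hker
  rw [hZc, nsmul_eq_mul, Nat.cast_sub (Nat.one_le_pow _ _ (by omega)),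
    show 2 * (l + 1) - 1 = 2 * l + 1 by omega, Nat.add_sub_cancel]
  push_cast
  ring

theorem leeW_comm (q : ℕ) {F : Type*} [Field F] [Fintype F] [DecidableEq F] [Algebra (ZMod q) F]
    (α β : F) : leeW q F α β = leeW q F β α :=
  add_comm _ _

section Isotropic

variable {q : ℕ} [Fact q.Prime] {F : Type*} [Field F] [Fintype F] [Algebra (ZMod q) F]

theorem trace_mul_surjective {α : F} (hα : α ≠ 0) :
    Function.Surjective (Algebra.trace (ZMod q) F ∘ₗ LinearMap.mulLeft (ZMod q) α) :=
  (Algebra.trace_surjective (ZMod q) F).comp (mul_left_surjective₀ hα)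

/-- For isotropic `α`, the lines `a + 𝔽_q α` not orthogonal to `α` each contain exactly one zero of
the quadratic form. -/
theorem card_trace_sq_eq_zero_trace_mul_ne_zero (hq : Odd q) {α : F}
    (hiso : Algebra.trace (ZMod q) F (α ^ 2) = 0) :
    #{a : F | Algebra.trace (ZMod q) F (a ^ 2) = 0 ∧ Algebra.trace (ZMod q) F (α * a) ≠ 0} * q =
      #{a : F | Algebra.trace (ZMod q) F (α * a) ≠ 0} := by
  have h2 : (2 : ZMod q) ≠ 0 := by
    have := Ring.two_ne_zero (R := ZMod q)
    apply this
    rw [ZMod.ringChar_zmod_n]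
    rintro rfl
    exact absurd hq (by decide)
  have hshift (a : F) (c : ZMod q) : Algebra.trace (ZMod q) F ((a + c • α) ^ 2)
      = Algebra.trace (ZMod q) F (a ^ 2) + 2 * c * Algebra.trace (ZMod q) F (α * a) := by
    rw [show (a + c • α) ^ 2 = a ^ 2 + (2 * c) • (α * a) + (c ^ 2) • α ^ 2 by
      simp only [Algebra.smul_def, map_mul, map_pow, map_ofNat]; ring]
    simp [hiso]
  have hpair (a : F) (c : ZMod q) : Algebra.trace (ZMod q) F (α * (a + c • α))
      = Algebra.trace (ZMod q) F (α * a) := by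
    rw [show α * (a + c • α) = α * a + c • α ^ 2 by simp only [Algebra.smul_def]; ring]
    simp [hiso]
  set A : Finset F :=
    {a : F | Algebra.trace (ZMod q) F (a ^ 2) = 0 ∧ Algebra.trace (ZMod q) F (α * a) ≠ 0} with hA
  have hcard : #(A ×ˢ (univ : Finset (ZMod q))) = #A * q := by
    rw [card_product, card_univ, ZMod.card]
  rw [← hcard]
  refine card_bij (fun p _ => p.1 + p.2 • α) ?_ ?_ ?_
  · rintro ⟨a, c⟩ h
    simp only [hA, mem_product, mem_filter, mem_univ, true_and, and_true] at h ⊢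
    rw [hpair]
    exact h.2
  · rintro ⟨a, c⟩ h ⟨b, d⟩ h' heq
    simp only [hA, mem_product, mem_filter, mem_univ, true_and, and_true] at h h' heq
    have hb : b = a + (c - d) • α := by
      rw [sub_smul]
      linear_combination -heq
    have hz := hshift a (c - d)
    rw [← hb, h.1, h'.1, zero_add, eq_comm, mul_eq_zero, mul_eq_zero] at hz
    have hcd : c = d := by
      rcases hz with (hz | hz) | hz
      · exact absurd hz h2
      · exact sub_eq_zero.mp hz
      · exact absurd hz h.2
    subst hcd
    simp [hb]
  · intro b hb
    simp only [mem_filter, mem_univ, true_and] at hb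
    set c : ZMod q := -Algebra.trace (ZMod q) F (b ^ 2) / (2 * Algebra.trace (ZMod q) F (α * b))
      with hc
    refine ⟨(b + c • α, -c), ?_, by simp⟩
    simp only [hA, mem_product, mem_filter, mem_univ, true_and, and_true]
    rw [hpair, hshift]
    refine ⟨?_, hb⟩
    rw [hc]
    generalize Algebra.trace (ZMod q) F (α * b) = t at hb
    field_simp
    ring

theorem card_trace_mul_ne_zero {α : F} (hα : α ≠ 0) {n : ℕ} (hF : Fintype.card F = q ^ (n + 1)) :
    #{a : F | Algebra.trace (ZMod q) F (α * a) ≠ 0} + q ^ n = q ^ (n + 1) := by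
  have hpos : 0 < q := (Fact.out : q.Prime).pos
  have h : #{a : F | Algebra.trace (ZMod q) F (α * a) = 0} * q = Fintype.card F :=
    card_filter_eq_mul_of_surjective _ (trace_mul_surjective hα) 0
  rw [hF, pow_succ] at h
  have h' := card_filter_add_card_filter_not (s := (univ : Finset F))
    (fun a => Algebra.trace (ZMod q) F (α * a) = 0)
  rw [Nat.eq_of_mul_eq_mul_right hpos h, card_univ, hF] at h'
  rw [add_comm]
  exact h'

theorem card_isotropic_not_orthogonal (hq : Odd q) {α : F} (hα : α ≠ 0)
    (hiso : Algebra.trace (ZMod q) F (α ^ 2) = 0) {n : ℕ} (hF : Fintype.card F = q ^ (n + 2)) :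
    (#{a : F | Algebra.trace (ZMod q) F (a ^ 2) = 0 ∧ Algebra.trace (ZMod q) F (α * a) ≠ 0} : ℤ) =
      ((q : ℤ) - 1) * (q : ℤ) ^ n := by
  have hpos : 0 < q := (Fact.out : q.Prime).pos
  have h := card_trace_mul_ne_zero hα (n := n + 1) hF
  rw [← card_trace_sq_eq_zero_trace_mul_ne_zero hq hiso] at h
  have h' := congrArg (Nat.cast : ℕ → ℤ) h
  push_cast at h'
  apply mul_right_cancel₀ (b := (q : ℤ)) (by exact_mod_cast hpos.ne')
  linear_combination h'

variable [DecidableEq F]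

theorem card_defSet_filter_fst (α : F) :
    #{p ∈ defSet q F | Algebra.trace (ZMod q) F (α * p.1) ≠ 0} =
      #{a : F | Algebra.trace (ZMod q) F (a ^ 2) = 0 ∧ Algebra.trace (ZMod q) F (α * a) ≠ 0} *
        #{b : F | Algebra.trace (ZMod q) F (b ^ 2) = 0} := by
  rw [← card_product]
  congr 1
  ext ⟨a, b⟩
  have : Algebra.trace (ZMod q) F (α * a) ≠ 0 → a ≠ 0 := by
    rintro h rfl
    simp at h
  simp only [defSet, mem_filter, mem_univ, true_and, mem_product, ne_eq, Prod.mk.injEq]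
  tauto

theorem card_defSet_filter_snd (α : F) :
    #{p ∈ defSet q F | Algebra.trace (ZMod q) F (α * p.2) ≠ 0} =
      #{p ∈ defSet q F | Algebra.trace (ZMod q) F (α * p.1) ≠ 0} := by
  refine card_equiv (Equiv.prodComm F F) ?_
  rintro ⟨a, b⟩
  simp only [defSet, mem_filter, mem_univ, true_and, ne_eq, Prod.mk.injEq, Equiv.prodComm_apply,
    Prod.swap_prod_mk]
  tauto

theorem leeW_zero_right (α : F) :
    leeW q F α 0 = 2 * #{p ∈ defSet q F | Algebra.trace (ZMod q) F (α * p.1) ≠ 0} := by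
  simp only [leeW, zero_mul, add_zero, zero_add]
  rw [card_defSet_filter_snd, two_mul]

end Isotropic

theorem stmt13 (q m : ℕ) [Fact q.Prime] (hq : Odd q) (hm : 2 ≤ m) (hmeven : Even m)
    (F : Type*) [Field F] [Fintype F] [DecidableEq F] [Algebra (ZMod q) F]
    (hF : Fintype.card F = q ^ m)
    (S : Finset (F × F))
    (hS : S = Finset.univ.filter (fun p : F × F =>
      (p.1 = 0 ∧ p.2 ≠ 0 ∧ Algebra.trace (ZMod q) F (p.2 ^ 2) = 0) ∨
      (p.1 ≠ 0 ∧ p.2 = 0 ∧ Algebra.trace (ZMod q) F (p.1 ^ 2) = 0))) :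
    (S.card : ℤ) = 2 * ((q : ℤ) ^ (m - 1) +
        epsEven q m * ((q : ℤ) - 1) * (q : ℤ) ^ ((m - 2) / 2) - 1) ∧
    ∀ p ∈ S, (leeW q F p.1 p.2 : ℤ) =
      2 * ((q : ℤ) - 1) * (q : ℤ) ^ (2 * m - 3) +
        2 * epsEven q m * ((q : ℤ) - 1) ^ 2 * (q : ℤ) ^ ((3 * m - 6) / 2) := by
  obtain ⟨l, rfl⟩ : ∃ l, m = 2 * (l + 1) := by
    obtain ⟨k, rfl⟩ := hmeven
    exact ⟨k - 1, by omega⟩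
  have hN := card_trace_sq_eq_zero_prime_field hq l.succ_ne_zero hF
  set Z : Finset F := {a : F | Algebra.trace (ZMod q) F (a ^ 2) = 0} with hZ
  rw [show 2 * (l + 1) - 1 = 2 * l + 1 by omega, Nat.succ_sub_one] at hN
  rw [show 2 * (l + 1) - 1 = 2 * l + 1 by omega, show (2 * (l + 1) - 2) / 2 = l by omega,
    show 2 * (2 * (l + 1)) - 3 = 4 * l + 1 by omega, show (3 * (2 * (l + 1)) - 6) / 2 = 3 * l by omega]
  refine ⟨?_, ?_⟩
  · have hSeq : S = ({0} : Finset F) ×ˢ Z.erase 0 ∪ Z.erase 0 ×ˢ ({0} : Finset F) := by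
      ext ⟨a, b⟩
      simp only [hS, hZ, mem_filter, mem_univ, true_and, mem_union, mem_product, mem_singleton,
        mem_erase]
      tauto
    have h0 : (0 : F) ∈ Z := by simp [hZ]
    rw [hSeq, card_union_of_disjoint, card_product, card_product, card_erase_of_mem h0,
      card_singleton, one_mul, mul_one, Nat.cast_add, Nat.cast_sub (card_pos.mpr ⟨0, h0⟩), hN]
    · push_cast
      ring
    · rw [disjoint_left]
      rintro ⟨a, b⟩ h h'
      simp only [mem_product, mem_singleton, mem_erase] at h h'
      exact h'.1.1 h.1
  · have key (α : F) (hα : α ≠ 0) (hiso : Algebra.trace (ZMod q) F (α ^ 2) = 0) :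
        (leeW q F α 0 : ℤ) = 2 * ((q : ℤ) - 1) * (q : ℤ) ^ (4 * l + 1) +
          2 * epsEven q (2 * (l + 1)) * ((q : ℤ) - 1) ^ 2 * (q : ℤ) ^ (3 * l) := by
      rw [leeW_zero_right, card_defSet_filter_fst, Nat.cast_mul, Nat.cast_mul, hN,
        card_isotropic_not_orthogonal hq hα hiso (n := 2 * l) hF]
      push_cast
      ring
    rintro ⟨a, b⟩ hp
    simp only [hS, mem_filter, mem_univ, true_and] at hp
    rcases hp with ⟨rfl, hb, hiso⟩ | ⟨ha, rfl, hiso⟩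
    · rw [leeW_comm]
      exact key b hb hiso
    · exact key a ha hiso
end

section
/- Let m ≥ 2 be even and let S = {(α,β) ∈ 𝔽_{q^m} × 𝔽_{q^m} : α ≠ 0, β ≠ 0, Tr(α²) = 0 and Tr(β²) = 0}. Then #S = (q^{m−1} + ε(q−1)q^{(m−2)/2} − 1)², and every (α,β) ∈ S satisfies W(α,β) = 2(q−1)q^{2m−3} + 4ε(q−1)²q^{(3m−6)/2} (an equality of integers, with ε = ±1 as defined). -/
open Finset

theorem AddMonoidHom.card_mul_card_fiber {G H : Type*} [AddGroup G] [Fintype G] [AddGroup H]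
    [Fintype H] [DecidableEq H] (f : G →+ H) (hf : Function.Surjective f) (h : H) :
    Fintype.card H * #{g | f g = h} = Fintype.card G := by
  have key : #(univ : Finset G) = ∑ b ∈ (univ : Finset H), #{a | f a = b} :=
    card_eq_sum_card_fiberwise (by simp)
  rw [sum_congr rfl fun b _ => AddMonoidHom.card_fiber_eq_of_mem_range f (hf b) (hf h)] at key
  simpa using key.symm

namespace FiniteField

theorem ringChar_ne_two_of_odd_card {F : Type*} [Field F] [Fintype F]
    (h : Odd (Fintype.card F)) : ringChar F ≠ 2 := fun h2 =>
  Nat.not_even_iff_odd.2 h (Nat.even_iff.2 (FiniteField.even_card_of_char_two h2))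

theorem card_mul_card_trace_mul_eq {K F : Type*} [Field K] [Fintype K] [DecidableEq K] [Field F]
    [Fintype F] [Algebra K F] {α : F} (hα : α ≠ 0) (t : K) :
    Fintype.card K * #{a : F | Algebra.trace K F (α * a) = t} = Fintype.card F := by
  let f : F →+ K := (Algebra.trace K F).toAddMonoidHom.comp (AddMonoidHom.mulLeft α)
  refine f.card_mul_card_fiber (fun c => ?_) t
  obtain ⟨x, hx⟩ := Algebra.trace_surjective K F c
  exact ⟨α⁻¹ * x, by simp [f, mul_inv_cancel_left₀ hα, hx]⟩

section Quadratic

variable {L F : Type*} [Field L] [Fintype L] [Field F] [Fintype F] [DecidableEq F] [Algebra L F]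

theorem quadraticChar_algebraMap_of_finrank_eq_two (h2 : Module.finrank L F = 2)
    (hL : Odd (Fintype.card L)) {c : L} (hc : c ≠ 0) :
    quadraticChar F (algebraMap L F c) = 1 := by
  have hcard : Fintype.card F = Fintype.card L ^ 2 := by
    rw [← h2, Module.card_eq_pow_finrank (K := L)]
  have hF : ringChar F ≠ 2 := ringChar_ne_two_of_odd_card (hcard ▸ hL.pow)
  rw [quadraticChar_eq_pow_of_char_ne_two hF (by simpa using hc), if_pos]
  obtain ⟨j, hj⟩ := hL
  have : Fintype.card F / 2 = (Fintype.card L - 1) * (j + 1) := by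
    rw [hcard, hj, Nat.add_sub_cancel]
    have : (2 * j + 1) ^ 2 = 2 * (2 * j * (j + 1)) + 1 := by ring
    omega
  rw [this, pow_mul, ← map_pow, FiniteField.pow_card_sub_one_eq_one c hc, map_one, one_pow]

theorem quadraticChar_of_trace_eq_zero (h2 : Module.finrank L F = 2)
    (hL : Odd (Fintype.card L)) {y : F} (hy : y ≠ 0) (ht : Algebra.trace L F y = 0) :
    quadraticChar F y = (-1) ^ ((Fintype.card L + 1) / 2) := by
  have hcard : Fintype.card F = Fintype.card L ^ 2 := by
    rw [← h2, Module.card_eq_pow_finrank (K := L)]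
  have hF : ringChar F ≠ 2 := ringChar_ne_two_of_odd_card (hcard ▸ hL.pow)
  have hpow : y ^ (Fintype.card L - 1) = -1 := by
    have := FiniteField.algebraMap_trace_eq_sum_pow L F y
    rw [ht, h2, map_zero, sum_range_succ, sum_range_one, pow_zero, pow_one, pow_one,
      Nat.card_eq_fintype_card] at this
    refine mul_right_cancel₀ hy ?_
    rw [← pow_succ, Nat.sub_add_cancel Fintype.card_pos]
    linear_combination -this
  have h1 := quadraticChar_eq_pow_of_char_ne_two hF hy
  obtain ⟨j, hj⟩ := hL
  have h3 : Fintype.card F / 2 = (Fintype.card L - 1) * ((Fintype.card L + 1) / 2) := by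
    rw [hcard, hj, Nat.add_sub_cancel]
    have h4 : (2 * j + 1) ^ 2 = 2 * (2 * j * (j + 1)) + 1 := by ring
    have h5 : (2 * j + 1 + 1) / 2 = j + 1 := by omega
    rw [h5]
    omega
  rw [h1, h3, pow_mul, hpow]
  have hne : (-1 : F) ≠ 1 := Ring.neg_one_ne_one_of_char_ne_two hF
  rcases neg_one_pow_eq_or ℤ ((Fintype.card L + 1) / 2) with h | h <;>
    rcases Nat.even_or_odd ((Fintype.card L + 1) / 2) with h' | h' <;>
    simp_all

theorem card_mul_sum_quadraticChar_trace_eq_zero {K : Type*} [Field K] [Fintype K]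
    [DecidableEq K] [Algebra K L] [Algebra K F] [IsScalarTower K L F]
    (h2 : Module.finrank L F = 2) (hL : Odd (Fintype.card L)) :
    (Fintype.card K : ℤ) * ∑ y : F with Algebra.trace K F y = 0, quadraticChar F y =
      (Fintype.card K - 1) * Fintype.card L * (-1) ^ ((Fintype.card L + 1) / 2) := by
  classical
  have hcard : Fintype.card F = Fintype.card L ^ 2 := by
    rw [← h2, Module.card_eq_pow_finrank (K := L)]
  have hF : ringChar F ≠ 2 := ringChar_ne_two_of_odd_card (hcard ▸ hL.pow)
  set e : ℤ := (-1) ^ ((Fintype.card L + 1) / 2)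
  set T : ℤ := ∑ y : F with Algebra.trace K F y = 0, quadraticChar F y
  set r := (Fintype.card L : ℤ) with hr
  set q := (Fintype.card K : ℤ) with hq
  have hker : ∑ y : F with Algebra.trace L F y = 0, quadraticChar F y = (r - 1) * e := by
    have h0 : (0 : F) ∈ univ.filter fun y : F => Algebra.trace L F y = 0 := by simp
    have hc : Fintype.card L * #{y : F | Algebra.trace L F y = 0} = Fintype.card F := by
      simpa using card_mul_card_trace_mul_eq (K := L) (one_ne_zero (α := F)) 0
    rw [hcard, sq] at hc
    have hc' := Nat.eq_of_mul_eq_mul_left Fintype.card_pos hc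
    rw [← add_sum_erase _ _ h0, sum_congr rfl (g := fun _ => e)]
    · rw [sum_const, card_erase_of_mem h0, hc', nsmul_eq_mul, Nat.cast_sub Fintype.card_pos]
      simp [hr]
    · intro y hy
      simp only [mem_erase, mem_filter, mem_univ, true_and] at hy
      exact quadraticChar_of_trace_eq_zero h2 hL hy.1 hy.2
  have hscale (c : L) (hc : c ≠ 0) :
      ∑ y : F with Algebra.trace K L (c * Algebra.trace L F y) = 0, quadraticChar F y = T := by
    have hc' : algebraMap L F c ≠ 0 := by simpa using hc
    refine sum_nbij' (fun y => algebraMap L F c * y) (fun y => (algebraMap L F c)⁻¹ * y) ?_ ?_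
      ?_ ?_ ?_
    · intro y hy
      simp only [mem_filter, mem_univ, true_and] at hy ⊢
      rw [← Algebra.trace_trace (S := L), ← Algebra.smul_def, map_smul, smul_eq_mul, hy]
    · intro y hy
      simp only [mem_filter, mem_univ, true_and] at hy ⊢
      rw [← smul_eq_mul c, ← map_smul, Algebra.smul_def, mul_inv_cancel_left₀ hc',
        Algebra.trace_trace, hy]
    · intro y _
      exact inv_mul_cancel_left₀ hc' y
    · intro y _
      exact mul_inv_cancel_left₀ hc' y
    · intro y _
      rw [map_mul, quadraticChar_algebraMap_of_finrank_eq_two h2 hL hc, one_mul]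
  have hinner (y : F) :
      q * #{c : L | c ≠ 0 ∧ Algebra.trace K L (c * Algebra.trace L F y) = 0} =
        (r - q) + if Algebra.trace L F y = 0 then (q - 1) * r else 0 := by
    have hsplit : (#{c : L | c ≠ 0 ∧ Algebra.trace K L (c * Algebra.trace L F y) = 0} : ℤ) =
        #{c : L | Algebra.trace K L (c * Algebra.trace L F y) = 0} - 1 := by
      rw [eq_sub_iff_add_eq]
      have h0 : (0 : L) ∈ univ.filter
        fun c : L => Algebra.trace K L (c * Algebra.trace L F y) = 0 := by simp
      rw [← card_erase_add_one h0]
      push_cast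
      congr 3
      ext c
      simp
    rw [hsplit]
    split_ifs with ht
    · simp only [ht, mul_zero, map_zero, filter_true, card_univ]
      ring
    · have := card_mul_card_trace_mul_eq (K := K) ht 0
      simp only [mul_comm _ (Algebra.trace L F y)]
      have : q * (#{c : L | Algebra.trace K L (Algebra.trace L F y * c) = 0} : ℤ) = r := by
        rw [hq, hr]
        exact_mod_cast this
      linear_combination this
  have hdouble : (r - 1) * T = ∑ y : F, quadraticChar F y *
      #{c : L | c ≠ 0 ∧ Algebra.trace K L (c * Algebra.trace L F y) = 0} := by
    have h1 : ∑ c : L with c ≠ 0, ∑ y : F with Algebra.trace K L (c * Algebra.trace L F y) = 0,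
        quadraticChar F y = (r - 1) * T := by
      rw [sum_congr rfl fun c hc => hscale c (mem_filter.1 hc).2, sum_const, filter_ne',
        card_erase_of_mem (mem_univ _), nsmul_eq_mul, card_univ, Nat.cast_sub Fintype.card_pos,
        Nat.cast_one]
    rw [← h1]
    simp only [sum_filter]
    rw [← sum_filter, sum_comm]
    refine sum_congr rfl fun y _ => ?_
    rw [← sum_filter, sum_const, filter_filter, nsmul_eq_mul, mul_comm]
  have hr1 : r - 1 ≠ 0 := by
    have : 1 < Fintype.card L := Fintype.one_lt_card
    omega
  refine mul_left_cancel₀ hr1 ?_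
  calc (r - 1) * (q * T) = q * ((r - 1) * T) := by ring
    _ = ∑ y : F, quadraticChar F y *
          ((r - q) + if Algebra.trace L F y = 0 then (q - 1) * r else 0) := by
      rw [hdouble, mul_sum]
      refine sum_congr rfl fun y _ => ?_
      rw [← hinner]
      ring
    _ = (r - q) * ∑ y : F, quadraticChar F y +
          (q - 1) * r * ∑ y : F with Algebra.trace L F y = 0, quadraticChar F y := by
      rw [sum_filter, mul_sum, mul_sum, ← sum_add_distrib]
      refine sum_congr rfl fun y _ => ?_
      split_ifs <;> ring
    _ = (r - 1) * ((q - 1) * r * e) := by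
      rw [quadraticChar_sum_zero hF, hker]
      ring

end Quadratic

theorem exists_intermediateField_finrank_eq_two (K F : Type*) [Field K] [Field F] [Finite F]
    [Algebra K F] (h : Even (Module.finrank K F)) :
    ∃ L : IntermediateField K F, Module.finrank L F = 2 := by
  have : Finite K := Finite.of_injective _ (algebraMap K F).injective
  have hc : Nat.card Gal(F/K) = Module.finrank K F := IsGalois.card_aut_eq_finrank K F
  obtain ⟨g, hg⟩ := exists_prime_orderOf_dvd_card' 2 (hc ▸ h.two_dvd)
  refine ⟨IntermediateField.fixedField (Subgroup.zpowers g), ?_⟩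
  rw [IntermediateField.finrank_fixedField_eq_card, Nat.card_zpowers, hg]

section TraceSq

variable {K F : Type*} [Field K] [Fintype K] [DecidableEq K] [Field F] [Fintype F]
  [Algebra K F]

theorem card_mul_card_trace_sq_eq_zero (hK : Odd (Fintype.card K)) {k : ℕ}
    (hk : Module.finrank K F = 2 * k) :
    (Fintype.card K : ℤ) * #{x : F | Algebra.trace K F (x ^ 2) = 0} =
      Fintype.card F + (Fintype.card K - 1) * Fintype.card K ^ k *
        (-1) ^ ((Fintype.card K ^ k + 1) / 2) := by
  classical
  obtain ⟨L, hL⟩ := exists_intermediateField_finrank_eq_two K F (by simp [hk])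
  have : Fintype L := Fintype.ofFinite L
  have hcL : Fintype.card L = Fintype.card K ^ k := by
    rw [Module.card_eq_pow_finrank (K := K)]
    have := Module.finrank_mul_finrank K L F
    congr 1
    rw [hL] at this
    omega
  have hF : ringChar F ≠ 2 :=
    ringChar_ne_two_of_odd_card (Module.card_eq_pow_finrank (K := K) (V := F) ▸ hK.pow)
  have hsum := card_mul_sum_quadraticChar_trace_eq_zero (K := K) hL (hcL ▸ hK.pow)
  have hker : Fintype.card K * #{y : F | Algebra.trace K F y = 0} = Fintype.card F := by
    simpa using card_mul_card_trace_mul_eq (K := K) (one_ne_zero (α := F)) 0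
  have hfib : (#{x : F | Algebra.trace K F (x ^ 2) = 0} : ℤ) =
      ∑ y : F with Algebra.trace K F y = 0, (quadraticChar F y + 1) := by
    rw [card_eq_sum_card_fiberwise (f := fun x : F => x ^ 2)
      (t := univ.filter fun y => Algebra.trace K F y = 0) (by intro x; simp)]
    push_cast
    refine sum_congr rfl fun y hy => ?_
    rw [← quadraticChar_card_sqrts hF]
    congr 2
    ext x
    simp only [mem_filter, mem_univ, true_and, Set.mem_toFinset, Set.mem_ofPred_eq] at hy ⊢
    exact ⟨And.right, fun h => ⟨h ▸ hy, h⟩⟩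
  rw [hfib, sum_add_distrib, mul_add, hsum, hcL, sum_const, nsmul_eq_mul, mul_one]
  push_cast [← hker]
  ring

theorem card_sq_mul_card_trace_sq_eq_zero_trace_mul_eq (hK : Odd (Fintype.card K)) {α : F}
    (hα : α ≠ 0) (hQ : Algebra.trace K F (α ^ 2) = 0) {t : K} (ht : t ≠ 0) :
    Fintype.card K ^ 2 *
      #{a : F | Algebra.trace K F (a ^ 2) = 0 ∧ Algebra.trace K F (α * a) = t} =
      Fintype.card F := by
  have h2 : (2 : K) ≠ 0 := Ring.two_ne_zero (ringChar_ne_two_of_odd_card hK)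
  have hsq (a : F) (s : K) : Algebra.trace K F ((a + s • α) ^ 2) =
      Algebra.trace K F (a ^ 2) + 2 * s * Algebra.trace K F (α * a) := by
    have : (a + s • α) ^ 2 = a ^ 2 + (2 * s) • (α * a) + (s ^ 2) • α ^ 2 := by
      simp only [Algebra.smul_def, map_mul, map_pow, map_ofNat]
      ring
    simp [this, hQ]
  have hmul (a : F) (s : K) : Algebra.trace K F (α * (a + s • α)) =
      Algebra.trace K F (α * a) := by
    have : α * (a + s • α) = α * a + s • α ^ 2 := by
      simp only [Algebra.smul_def]
      ring
    simp [this, hQ]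
  rw [← card_mul_card_trace_mul_eq (K := K) hα t, sq, mul_assoc]
  congr 1
  rw [← card_univ, ← card_product]
  refine card_nbij' (fun p => p.2 + p.1 • α)
    (fun a => (Algebra.trace K F (a ^ 2) / (2 * t),
      a + (-(Algebra.trace K F (a ^ 2) / (2 * t))) • α)) ?_ ?_ ?_ ?_
  · rintro ⟨s, a⟩ h
    simp only [coe_product, coe_univ, coe_filter, mem_univ, true_and, Set.mem_prod, Set.mem_univ,
      Set.mem_ofPred_eq] at h ⊢
    rw [hmul, h.2]
  · intro a h
    simp only [coe_product, coe_univ, coe_filter, mem_univ, true_and, Set.mem_prod, Set.mem_univ,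
      Set.mem_ofPred_eq] at h ⊢
    rw [hmul, hsq, h]
    refine ⟨?_, rfl⟩
    field_simp
    ring
  · rintro ⟨s, a⟩ h
    simp only [coe_product, coe_univ, coe_filter, mem_univ, true_and, Set.mem_prod, Set.mem_univ,
      Set.mem_ofPred_eq] at h
    have : Algebra.trace K F ((a + s • α) ^ 2) / (2 * t) = s := by
      rw [hsq, h.1, h.2]
      field_simp
      ring
    simp [this]
  · intro a _
    simp

end TraceSq

end FiniteField

theorem neg_one_pow_card_half_eq_epsEven {q k : ℕ} (hq : Odd q) :
    (-1 : ℤ) ^ ((q ^ k + 1) / 2) = epsEven q (2 * k) := by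
  have hodd : q ^ k % 2 = 1 := Nat.odd_iff.1 hq.pow
  have h1 : (q ^ k + 1) / 2 = q ^ k / 2 + 1 := by omega
  rw [h1, pow_succ, ← ZMod.χ₄_eq_neg_one_pow hodd, Nat.cast_pow, map_pow,
    ZMod.χ₄_eq_neg_one_pow (Nat.odd_iff.1 hq), epsEven]
  obtain ⟨j, rfl⟩ := hq
  have h2 : (2 * j + 1) / 2 = j := by omega
  have h3 : (2 * j + 1 - 1) ^ 2 * (2 * k) / 8 = j * j * k := by
    rw [Nat.add_sub_cancel]
    have : (2 * j) ^ 2 * (2 * k) = 8 * (j * j * k) := by ring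
    omega
  rw [h2, h3, pow_mul, pow_mul, ← pow_mul]
  rcases Nat.even_or_odd j with h | h <;> simp [h.neg_one_pow, pow_mul]

theorem card_filter_trace_ne_zero {q : ℕ} [Fact q.Prime] (hq : Odd q) {F : Type*} [Field F]
    [Fintype F] [DecidableEq F] [Algebra (ZMod q) F] {α β : F} (hα : α ≠ 0) (hβ : β ≠ 0)
    (hαQ : Algebra.trace (ZMod q) F (α ^ 2) = 0) (hβQ : Algebra.trace (ZMod q) F (β ^ 2) = 0)
    {N n : ℤ} (hN : (#{x : F | Algebra.trace (ZMod q) F (x ^ 2) = 0} : ℤ) = N)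
    (hn : (q : ℤ) ^ 2 * n = Fintype.card F) :
    (#((defSet q F).filter
      fun p => Algebra.trace (ZMod q) F (α * p.1 + β * p.2) ≠ 0) : ℤ) =
      N ^ 2 - ((N - (q - 1) * n) ^ 2 + (q - 1) * n ^ 2) := by
  set Z : Finset F := {x : F | Algebra.trace (ZMod q) F (x ^ 2) = 0} with hZ
  have hq0 : (q : ℤ) ≠ 0 := by exact_mod_cast (Fact.out : q.Prime).ne_zero
  have hfib {γ : F} (hγ : γ ≠ 0) (hγQ : Algebra.trace (ZMod q) F (γ ^ 2) = 0) {t : ZMod q}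
      (ht : t ≠ 0) : (#{a ∈ Z | Algebra.trace (ZMod q) F (γ * a) = t} : ℤ) = n := by
    have h := FiniteField.card_sq_mul_card_trace_sq_eq_zero_trace_mul_eq (K := ZMod q)
      (by simpa [ZMod.card] using hq) hγ hγQ ht
    rw [ZMod.card] at h
    refine mul_left_cancel₀ (pow_ne_zero 2 hq0) ?_
    rw [hn, hZ, filter_filter]
    exact_mod_cast h
  have hcard (x : ℤ) : ∑ t ∈ (univ : Finset (ZMod q)).erase 0, x = (q - 1) * x := by
    rw [sum_const, card_erase_of_mem (mem_univ _), card_univ, ZMod.card, nsmul_eq_mul,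
      Nat.cast_sub (Fact.out : q.Prime).one_le, Nat.cast_one]
  have hfib0 {γ : F} (hγ : γ ≠ 0) (hγQ : Algebra.trace (ZMod q) F (γ ^ 2) = 0) :
      (#{a ∈ Z | Algebra.trace (ZMod q) F (γ * a) = 0} : ℤ) = N - (q - 1) * n := by
    have h := card_eq_sum_card_fiberwise (s := Z) (t := univ)
      (f := fun a => Algebra.trace (ZMod q) F (γ * a)) (by simp)
    rw [← add_sum_erase _ _ (mem_univ 0)] at h
    zify at h
    rw [hN, sum_congr rfl fun t ht => hfib hγ hγQ (mem_erase.1 ht).1, hcard] at h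
    linear_combination -h
  have hzero : (#{p ∈ Z ×ˢ Z | Algebra.trace (ZMod q) F (α * p.1 + β * p.2) = 0} : ℤ) =
      (N - (q - 1) * n) ^ 2 + (q - 1) * n ^ 2 := by
    have h := card_eq_sum_card_fiberwise
      (s := {p ∈ Z ×ˢ Z | Algebra.trace (ZMod q) F (α * p.1 + β * p.2) = 0}) (t := univ)
      (f := fun p => Algebra.trace (ZMod q) F (α * p.1)) (by simp)
    have hprod (t : ZMod q) : #{p ∈ {p ∈ Z ×ˢ Z |
        Algebra.trace (ZMod q) F (α * p.1 + β * p.2) = 0} |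
          Algebra.trace (ZMod q) F (α * p.1) = t} =
        #{a ∈ Z | Algebra.trace (ZMod q) F (α * a) = t} *
          #{b ∈ Z | Algebra.trace (ZMod q) F (β * b) = -t} := by
      rw [← card_product]
      congr 1
      ext ⟨a, b⟩
      simp only [mem_filter, mem_product, map_add]
      constructor
      · rintro ⟨⟨⟨ha, hb⟩, h⟩, rfl⟩
        exact ⟨⟨ha, rfl⟩, hb, eq_neg_of_add_eq_zero_right h⟩
      · rintro ⟨⟨ha, rfl⟩, hb, h⟩
        exact ⟨⟨⟨ha, hb⟩, by rw [h, add_neg_cancel]⟩, rfl⟩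
    simp only [hprod] at h
    rw [← add_sum_erase _ _ (mem_univ 0), neg_zero] at h
    zify at h
    rw [hfib0 hα hαQ, hfib0 hβ hβQ, sum_congr rfl fun t ht => by
      rw [hfib hα hαQ (mem_erase.1 ht).1, hfib hβ hβQ (neg_ne_zero.2 (mem_erase.1 ht).1)],
      hcard] at h
    rw [h]
    ring
  have hsplit := card_filter_add_card_filter_not (s := Z ×ˢ Z)
    (fun p : F × F => Algebra.trace (ZMod q) F (α * p.1 + β * p.2) = 0)
  rw [card_product] at hsplit
  zify at hsplit
  rw [hzero, hN] at hsplit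
  have hD : (defSet q F).filter
      (fun p => Algebra.trace (ZMod q) F (α * p.1 + β * p.2) ≠ 0) =
      {p ∈ Z ×ˢ Z | ¬ Algebra.trace (ZMod q) F (α * p.1 + β * p.2) = 0} := by
    ext ⟨a, b⟩
    simp only [defSet, hZ, mem_filter, mem_univ, true_and, mem_product]
    constructor
    · rintro ⟨⟨-, h⟩, h'⟩
      exact ⟨h, h'⟩
    · rintro ⟨h, h'⟩
      refine ⟨⟨?_, h⟩, h'⟩
      rintro ⟨⟩
      simp at h'
  rw [hD]
  linear_combination hsplit

theorem stmt15 (q m : ℕ) [Fact q.Prime] (hq : Odd q) (hm : 2 ≤ m) (hmeven : Even m)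
    (F : Type*) [Field F] [Fintype F] [DecidableEq F] [Algebra (ZMod q) F]
    (hF : Fintype.card F = q ^ m)
    (S : Finset (F × F))
    (hS : S = Finset.univ.filter (fun p : F × F =>
      p.1 ≠ 0 ∧ p.2 ≠ 0 ∧ Algebra.trace (ZMod q) F (p.1 ^ 2) = 0 ∧
        Algebra.trace (ZMod q) F (p.2 ^ 2) = 0)) :
    (S.card : ℤ) = ((q : ℤ) ^ (m - 1) +
        epsEven q m * ((q : ℤ) - 1) * (q : ℤ) ^ ((m - 2) / 2) - 1) ^ 2 ∧
    ∀ p ∈ S, (leeW q F p.1 p.2 : ℤ) =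
      2 * ((q : ℤ) - 1) * (q : ℤ) ^ (2 * m - 3) +
        4 * epsEven q m * ((q : ℤ) - 1) ^ 2 * (q : ℤ) ^ ((3 * m - 6) / 2) := by
  have hqp : q.Prime := Fact.out
  obtain ⟨n, rfl⟩ : ∃ n, m = 2 * (n + 1) := by
    obtain ⟨k, rfl⟩ := hmeven
    exact ⟨k - 1, by omega⟩
  have hq0 : (q : ℤ) ≠ 0 := by exact_mod_cast hqp.ne_zero
  have hrank : Module.finrank (ZMod q) F = 2 * (n + 1) := by
    have h := Module.card_eq_pow_finrank (K := ZMod q) (V := F)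
    rw [ZMod.card, hF] at h
    exact (Nat.pow_right_injective hqp.two_le h).symm
  set e : ℤ := epsEven q (2 * (n + 1)) with he
  have he2 : e ^ 2 = 1 := by
    rw [he, epsEven, neg_sq, ← pow_mul, mul_comm, pow_mul]
    simp
  have hN : (#{x : F | Algebra.trace (ZMod q) F (x ^ 2) = 0} : ℤ) =
      (q : ℤ) ^ (2 * n + 1) + e * (q - 1) * (q : ℤ) ^ n := by
    have h := FiniteField.card_mul_card_trace_sq_eq_zero (K := ZMod q)
      (by simpa [ZMod.card] using hq) hrank
    rw [ZMod.card, neg_one_pow_card_half_eq_epsEven hq, hF] at h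
    refine mul_left_cancel₀ hq0 (h.trans ?_)
    push_cast
    ring
  have hn : (q : ℤ) ^ 2 * (q : ℤ) ^ (2 * n) = Fintype.card F := by
    rw [hF]
    push_cast
    ring
  have h1 : 2 * (n + 1) - 1 = 2 * n + 1 := by omega
  have h2 : (2 * (n + 1) - 2) / 2 = n := by omega
  have h3 : 2 * (2 * (n + 1)) - 3 = 4 * n + 1 := by omega
  have h4 : (3 * (2 * (n + 1)) - 6) / 2 = 3 * n := by omega
  rw [h1, h2, h3, h4]
  subst hS
  constructor
  · have hprod : (univ.filter fun p : F × F => p.1 ≠ 0 ∧ p.2 ≠ 0 ∧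
        Algebra.trace (ZMod q) F (p.1 ^ 2) = 0 ∧ Algebra.trace (ZMod q) F (p.2 ^ 2) = 0) =
        (univ.filter fun x : F => Algebra.trace (ZMod q) F (x ^ 2) = 0).erase 0 ×ˢ
        (univ.filter fun x : F => Algebra.trace (ZMod q) F (x ^ 2) = 0).erase 0 := by
      ext ⟨a, b⟩
      simp only [mem_filter, mem_univ, true_and, mem_product, mem_erase]
      tauto
    have h0 : (0 : F) ∈ univ.filter fun x : F => Algebra.trace (ZMod q) F (x ^ 2) = 0 := by simp
    rw [hprod, card_product, card_erase_of_mem h0, Nat.cast_mul,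
      Nat.cast_sub (card_pos.2 ⟨0, h0⟩), hN]
    push_cast
    ring
  · rintro ⟨α, β⟩ hp
    simp only [mem_filter, mem_univ, true_and] at hp
    obtain ⟨hα, hβ, hαQ, hβQ⟩ := hp
    rw [leeW, Nat.cast_add, card_filter_trace_ne_zero hq hα hβ hαQ hβQ hN hn,
      card_filter_trace_ne_zero hq hβ hα hβQ hαQ hN hn]
    ring
end

section
/- Let m ≥ 5 be odd. Then every nonzero codeword of the q-ary linear code φ(C_D) is minimal: for all (α,β), (α′,β′) ∈ 𝔽_{q^m} × 𝔽_{q^m} such that c_{α,β} ≠ 0, c_{α′,β′} ≠ 0 and supp(c_{α′,β′}) ⊆ supp(c_{α,β}), there exists λ ∈ 𝔽_q, λ ≠ 0, with c_{α′,β′} = λ·c_{α,β}. -/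
/-- The index set of the Gray image: the defining set
`D = {(a,b) ≠ (0,0) : Tr(a²) = 0 and Tr(b²) = 0}` as a subtype. -/
def DefIdx (q : ℕ) (F : Type*) [Field F] [Fintype F] [Algebra (ZMod q) F] :=
  {p : F × F // p ≠ (0, 0) ∧ Algebra.trace (ZMod q) F (p.1 ^ 2) = 0 ∧
    Algebra.trace (ZMod q) F (p.2 ^ 2) = 0}

/-- The Gray-image codeword `c_{α,β}` of `φ(C_D)`, with coordinates
`c_{α,β}((a,b),1) = Tr(αa + βb)` and `c_{α,β}((a,b),2) = Tr(βa + αb)`. -/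
noncomputable def grayCW (q : ℕ) (F : Type*) [Field F] [Fintype F] [Algebra (ZMod q) F]
    (α β : F) (j : DefIdx q F × Fin 2) : ZMod q :=
  if j.2 = 0 then Algebra.trace (ZMod q) F (α * j.1.val.1 + β * j.1.val.2)
  else Algebra.trace (ZMod q) F (β * j.1.val.1 + α * j.1.val.2)

section IsotropicVectors

variable {K V : Type*} [Field K] [AddCommGroup V] [Module K V]

/-- Over a finite field, a bilinear form on a space of dimension at least `5` has a nonzero
isotropic vector in the common kernel of any two linear functionals. -/
theorem exists_isotropic_of_five_le_finrank [Finite K] [FiniteDimensional K V]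
    (hV : 5 ≤ Module.finrank K V) (B : LinearMap.BilinForm K V) (f g : Module.Dual K V) :
    ∃ z : V, z ≠ 0 ∧ B z z = 0 ∧ f z = 0 ∧ g z = 0 := by
  classical
  have := Fintype.ofFinite K
  let b := Module.finBasis K V
  let ℓ (h : Module.Dual K V) : MvPolynomial (Fin (Module.finrank K V)) K :=
    ∑ i, MvPolynomial.C (h (b i)) * MvPolynomial.X i
  let Q : MvPolynomial (Fin (Module.finrank K V)) K :=
    ∑ i, ∑ j, MvPolynomial.C (B (b i) (b j)) * (MvPolynomial.X i * MvPolynomial.X j)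
  have hℓ (h : Module.Dual K V) : (ℓ h).totalDegree ≤ 1 := by
    refine MvPolynomial.totalDegree_finsetSum_le fun i _ => ?_
    refine (MvPolynomial.totalDegree_mul _ _).trans ?_
    simp
  have hQ : Q.totalDegree ≤ 2 := by
    refine MvPolynomial.totalDegree_finsetSum_le fun i _ => ?_
    refine MvPolynomial.totalDegree_finsetSum_le fun j _ => ?_
    refine (MvPolynomial.totalDegree_mul _ _).trans ?_
    rw [MvPolynomial.totalDegree_C, zero_add]
    refine (MvPolynomial.totalDegree_mul _ _).trans ?_
    simp
  have hdeg : ∑ i, (![Q, ℓ f, ℓ g] i).totalDegree < Fintype.card (Fin (Module.finrank K V)) := by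
    have hf := hℓ f
    have hg := hℓ g
    simp only [Fin.sum_univ_three, Fintype.card_fin, Matrix.cons_val]
    omega
  obtain ⟨p, _⟩ := CharP.exists K
  have hp := CharP.char_is_prime K p
  have hdvd := char_dvd_card_solutions_of_fintype_sum_lt p hdeg
  rw [Fintype.card_eq_nat_card] at hdvd
  let zero : {x : Fin (Module.finrank K V) → K //
      ∀ i, MvPolynomial.eval x (![Q, ℓ f, ℓ g] i) = 0} :=
    ⟨0, by simp [Fin.forall_fin_succ, Q, ℓ]⟩
  have := Nonempty.intro zero
  have hcard := hp.one_lt.trans_le (Nat.le_of_dvd Nat.card_pos hdvd)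
  have := Finite.one_lt_card_iff_nontrivial.mp hcard
  obtain ⟨⟨x, hx⟩, hx0⟩ := exists_ne zero
  have hQx : MvPolynomial.eval x Q = 0 := hx 0
  have hdual (h : Module.Dual K V) (hh : MvPolynomial.eval x (ℓ h) = 0) :
      h (∑ i, x i • b i) = 0 := by
    rw [← hh]
    simp [ℓ, mul_comm]
  refine ⟨∑ i, x i • b i, fun h => hx0 ?_, ?_, hdual f (hx 1), hdual g (hx 2)⟩
  · exact Subtype.ext (funext (Fintype.linearIndependent_iff.mp b.linearIndependent x h))
  · rw [← hQx]
    simp only [Q, map_sum, map_mul, MvPolynomial.eval_C, MvPolynomial.eval_X, map_smul,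
      LinearMap.sum_apply, LinearMap.smul_apply, smul_eq_mul,
      Finset.mul_sum]
    rw [Finset.sum_comm]
    exact Finset.sum_congr rfl fun i _ => Finset.sum_congr rfl fun j _ => by ring

/-- For a nondegenerate form, `y` is a multiple of `x` as soon as `x^⊥ ≤ y^⊥`. -/
theorem exists_eq_smul_of_orthogonal_le {B : LinearMap.BilinForm K V} (hB : B.Nondegenerate)
    {x y : V} (h : ∀ w, B x w = 0 → B y w = 0) : ∃ c : K, y = c • x := by
  have hmem := mem_span_of_iInf_ker_le_ker (L := fun _ : Unit => B x) (K := B y) fun w hw =>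
    h w (by simpa using hw)
  rw [Set.range_const, Submodule.mem_span_singleton] at hmem
  obtain ⟨c, hc⟩ := hmem
  exact ⟨c, (LinearMap.ker_eq_bot.mp hB.ker_eq_bot) (by simpa using hc.symm)⟩

/-- If every isotropic vector orthogonal to `x` is orthogonal to `y`, then `y` is a multiple
of `x`. -/
theorem exists_eq_smul_of_isotropic_orthogonal [Finite K] [FiniteDimensional K V]
    (h2 : (2 : K) ≠ 0) (hV : 5 ≤ Module.finrank K V) {B : LinearMap.BilinForm K V}
    (hB : B.Nondegenerate) (hsymm : B.IsSymm) {x y : V}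
    (h : ∀ a, B a a = 0 → B x a = 0 → B y a = 0) : ∃ c : K, y = c • x := by
  by_contra hy
  obtain ⟨z, hz0, hzz, hxz, hz⟩ : ∃ z, z ≠ 0 ∧ B z z = 0 ∧ B x z = 0 ∧ ¬ ∃ c : K, z = c • x := by
    obtain ⟨γ, hγ⟩ : ∃ γ, x ≠ 0 → B γ x ≠ 0 := by
      by_contra! hγ
      exact (hγ 0).1 (hB.2 x fun γ => (hγ γ).2)
    obtain ⟨z, hz0, hzz, hxz, hγz⟩ := exists_isotropic_of_five_le_finrank hV B (B x) (B γ)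
    refine ⟨z, hz0, hzz, hxz, ?_⟩
    rintro ⟨c, rfl⟩
    have hx : x ≠ 0 := fun hx => hz0 (by simp [hx])
    have hc : c ≠ 0 := fun hc => hz0 (by simp [hc])
    simp [hc, hγ hx] at hγz
  obtain ⟨w₁, hxw₁, hzw₁⟩ : ∃ w, B x w = 0 ∧ B z w ≠ 0 := by
    by_contra! hw
    exact hz (exists_eq_smul_of_orthogonal_le hB hw)
  obtain ⟨w₂, hxw₂, hyw₂⟩ : ∃ w, B x w = 0 ∧ B y w ≠ 0 := by
    by_contra! hw
    exact hy (exists_eq_smul_of_orthogonal_le hB hw)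
  obtain ⟨w, hxw, hzw, hyw⟩ : ∃ w, B x w = 0 ∧ B z w ≠ 0 ∧ B y w ≠ 0 := by
    by_cases hyw₁ : B y w₁ = 0
    · by_cases hzw₂ : B z w₂ = 0
      · exact ⟨w₁ + w₂, by simp [hxw₁, hxw₂], by simpa [hzw₂], by simpa [hyw₁]⟩
      · exact ⟨w₂, hxw₂, hzw₂, hyw₂⟩
    · exact ⟨w₁, hxw₁, hzw₁, hyw₁⟩
  have hwz : B w z = B z w := (hsymm.eq z w).symm
  let t : K := -B w w / (2 * B z w)
  have key := h (w + t • z) (by simp [hzz, hwz, t]; field_simp; ring) (by simp [hxw, hxz])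
  simp [h z hzz hxz, hyw] at key

/-- A pair of vectors is determined up to a scalar by the vanishing, on pairs of isotropic
vectors, of the linear functional it defines. -/
theorem exists_eq_smul_prod_of_isotropic [Finite K] [FiniteDimensional K V]
    (h2 : (2 : K) ≠ 0) (hV : 5 ≤ Module.finrank K V) {B : LinearMap.BilinForm K V}
    (hB : B.Nondegenerate) (hsymm : B.IsSymm) {x y x' y' : V}
    (h : ∀ a b, B a a = 0 → B b b = 0 → B x a + B y b = 0 → B x' a + B y' b = 0) :
    ∃ c : K, x' = c • x ∧ y' = c • y := by
  obtain ⟨c, rfl⟩ : ∃ c : K, x' = c • x :=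
    exists_eq_smul_of_isotropic_orthogonal h2 hV hB hsymm fun a ha hxa => by
      simpa using h a 0 ha (by simp) (by simpa using hxa)
  obtain ⟨d, rfl⟩ : ∃ d : K, y' = d • y :=
    exists_eq_smul_of_isotropic_orthogonal h2 hV hB hsymm fun b hb hyb => by
      simpa using h 0 b (by simp) hb (by simpa using hyb)
  have hex {v : V} (hv : v ≠ 0) : ∃ a, B a a = 0 ∧ B v a ≠ 0 := by
    by_contra! hva
    obtain ⟨c, hc⟩ := exists_eq_smul_of_isotropic_orthogonal (x := 0) (y := v) h2 hV hB hsymm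
      fun a ha _ => hva a ha
    exact hv (by simpa using hc)
  by_cases hx : x = 0
  · exact ⟨d, by simp [hx], rfl⟩
  by_cases hy : y = 0
  · exact ⟨c, rfl, by simp [hy]⟩
  obtain ⟨a, ha, hxa⟩ := hex hx
  obtain ⟨b, hb, hyb⟩ := hex hy
  have key := h a (-(B x a / B y b) • b) ha (by simp [hb]) (by simp [hyb])
  have hcd : (c - d) * B x a = 0 := by
    rw [← key]
    simp
    field_simp
    ring
  obtain rfl : c = d := sub_eq_zero.mp ((mul_eq_zero.mp hcd).resolve_right hxa)
  exact ⟨c, rfl, rfl⟩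

end IsotropicVectors

theorem stmt18 (q m : ℕ) [Fact q.Prime] (hq : Odd q) (hm : 5 ≤ m) (hmodd : Odd m)
    (F : Type*) [Field F] [Fintype F] [DecidableEq F] [Algebra (ZMod q) F]
    (hF : Fintype.card F = q ^ m) :
    ∀ α β α' β' : F, grayCW q F α β ≠ 0 → grayCW q F α' β' ≠ 0 →
      Function.support (grayCW q F α' β') ⊆ Function.support (grayCW q F α β) →
      ∃ lam : ZMod q, lam ≠ 0 ∧ grayCW q F α' β' = fun j => lam * grayCW q F α β j := by
  intro α β α' β' _ hne hsupp
  have hfin : FiniteDimensional (ZMod q) F := .of_finite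
  have hrank : 5 ≤ Module.finrank (ZMod q) F := by
    have hcard := Module.card_eq_pow_finrank (K := ZMod q) (V := F)
    rw [hF, ZMod.card] at hcard
    rwa [← Nat.pow_right_injective (Fact.out : q.Prime).two_le hcard]
  have h2 : (2 : ZMod q) ≠ 0 := by
    refine Ring.two_ne_zero ?_
    rw [ZMod.ringChar_zmod_n]
    rintro rfl
    exact absurd hq (by decide)
  obtain ⟨c, rfl, rfl⟩ := exists_eq_smul_prod_of_isotropic (x := α) (y := β) (x' := α') (y' := β')
    h2 hrank (traceForm_nondegenerate (ZMod q) F) (Algebra.traceForm_isSymm (ZMod q))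
    fun a b ha hb hab => by
      by_cases h0 : (a, b) = (0, 0)
      · obtain ⟨rfl, rfl⟩ := Prod.mk.inj h0
        simp
      by_contra hab'
      simp only [Algebra.traceForm_apply, ← map_add, ← pow_two] at ha hb hab hab'
      have hmem := @hsupp (⟨(a, b), h0, ha, hb⟩, 0) (by simpa [grayCW] using hab')
      exact hmem (by simpa [grayCW] using hab)
  have heq : grayCW q F (c • α) (c • β) = fun j => c * grayCW q F α β j := by
    funext j
    simp only [grayCW, smul_mul_assoc, ← smul_add, map_smul, smul_eq_mul, mul_ite]
  refine ⟨c, ?_, heq⟩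
  rintro rfl
  exact hne (by rw [heq]; funext j; simp)
end

section
/- Let m ≥ 6 be even. Then every nonzero codeword of the q-ary linear code φ(C_D) is minimal: for all (α,β), (α′,β′) ∈ 𝔽_{q^m} × 𝔽_{q^m} such that c_{α,β} ≠ 0, c_{α′,β′} ≠ 0 and supp(c_{α′,β′}) ⊆ supp(c_{α,β}), there exists λ ∈ 𝔽_q, λ ≠ 0, with c_{α′,β′} = λ·c_{α,β}. -/
open Module Submodule in
/-- If a subspace of dimension at most half that of the ambient space contains an anisotropic
vector, then so does its orthogonal complement. -/
theorem exists_anisotropic_mem_orthogonal {K V : Type*} [Field K] [AddCommGroup V] [Module K V]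
    [FiniteDimensional K V] (B : LinearMap.BilinForm K V) (hB : B.Nondegenerate) (hs : B.IsSymm)
    (h2 : (2 : K) ≠ 0) (T : Submodule K V) (hT : 2 * finrank K T ≤ finrank K V)
    {w : V} (hw : w ∈ T) (hww : B w w ≠ 0) : ∃ x ∈ B.orthogonal T, B x x ≠ 0 := by
  by_contra! h
  have hle : B.orthogonal T ≤ T := by
    intro x hx
    rw [← LinearMap.BilinForm.orthogonal_orthogonal hB hs.isRefl T]
    intro y hy
    have hxy := h (x + y) (add_mem hx hy)
    have hcomm : B x y = B y x := hs.eq x y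
    simp only [map_add, LinearMap.add_apply, h x hx, h y hy, hcomm] at hxy
    have h2xy : 2 * B y x = 0 := by linear_combination hxy
    exact (mul_eq_zero.mp h2xy).resolve_left h2
  have hrank := LinearMap.BilinForm.finrank_orthogonal hB T
  have heq : B.orthogonal T = T := eq_of_le_of_finrank_le hle (by omega)
  exact hww (h w (by rwa [heq]))

open Polynomial in
/-- A diagonal binary quadratic form over a finite field of odd order represents every element. -/
theorem exists_mul_sq_add_mul_sq_eq {K : Type*} [Field K] [Fintype K]
    (hK : Fintype.card K % 2 = 1) {a b : K} (ha : a ≠ 0) (hb : b ≠ 0) (c : K) :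
    ∃ s t : K, a * s ^ 2 + b * t ^ 2 = c := by
  obtain ⟨s, t, h⟩ := FiniteField.exists_root_sum_quadratic
    (f := C a * X ^ 2 + C 0 * X + C 0) (g := C b * X ^ 2 + C 0 * X + C (-c))
    (degree_quadratic ha) (degree_quadratic hb) hK
  refine ⟨s, t, ?_⟩
  simp only [eval_add, eval_mul, eval_C, eval_pow, eval_X] at h
  linear_combination h

open Module Submodule in
/-- Over a finite field of odd order, a vector orthogonal to all isotropic vectors of the hyperplane
`u^⊥` of a nondegenerate quadratic space of dimension at least `6` is a multiple of `u`. -/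
theorem mem_span_singleton_of_isotropic_orthogonal {K V : Type*} [Field K] [Fintype K]
    [AddCommGroup V] [Module K V] [FiniteDimensional K V] (B : LinearMap.BilinForm K V)
    (hB : B.Nondegenerate) (hs : B.IsSymm) (hK : Fintype.card K % 2 = 1) (h2 : (2 : K) ≠ 0)
    (hV : 6 ≤ finrank K V) {u v : V}
    (h : ∀ a, B a a = 0 → B u a = 0 → B v a = 0) : v ∈ span K {u} := by
  classical
  rw [← LinearMap.BilinForm.orthogonal_orthogonal hB hs.isRefl (span K {u})]
  intro w hw
  have huw : B u w = 0 := hw u (mem_span_singleton_self u)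
  have hcomm : ∀ x y, B x y = B y x := fun x y => hs.eq x y
  rw [hcomm]
  by_cases hww : B w w = 0
  · exact h w hww huw
  have hcard : ∀ s : Finset V, finrank K (span K (s : Set V)) ≤ s.card :=
    fun s => finrank_span_finset_le_card s
  have hc2 := hcard {u, w}
  obtain ⟨x, hx, hxx⟩ := exists_anisotropic_mem_orthogonal B hB hs h2
    (span K (({u, w} : Finset V) : Set V))
    (by have := Finset.card_le_two (a := u) (b := w); omega)
    (subset_span (by simp : w ∈ _)) hww
  have hc3 := hcard {u, w, x}
  obtain ⟨y, hy, hyy⟩ := exists_anisotropic_mem_orthogonal B hB hs h2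
    (span K (({u, w, x} : Finset V) : Set V))
    (by have := Finset.card_le_three (a := u) (b := w) (c := x); omega)
    (subset_span (by simp : w ∈ _)) hww
  have hux : B u x = 0 := hx u (subset_span (by simp))
  have hwx : B w x = 0 := hx w (subset_span (by simp))
  have huy : B u y = 0 := hy u (subset_span (by simp))
  have hwy : B w y = 0 := hy w (subset_span (by simp))
  have hxy : B x y = 0 := hy x (subset_span (by simp))
  obtain ⟨s, t, hst⟩ := exists_mul_sq_add_mul_sq_eq hK hxx hyy (-B w w)
  have key : ∀ e : K, e ^ 2 = 1 → B v (w + e • (s • x + t • y)) = 0 := by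
    intro e he
    apply h
    · simp only [map_add, map_smul, LinearMap.add_apply, LinearMap.smul_apply, smul_eq_mul,
        hcomm x w, hcomm y w, hcomm y x, hwx, hwy, hxy]
      linear_combination (e ^ 2) * hst - B w w * he
    · simp [huw, hux, huy]
  have h₁ := key 1 (by ring)
  have h₂ := key (-1) (by ring)
  simp only [map_add, map_smul, smul_eq_mul] at h₁ h₂
  have h2vw : 2 * B v w = 0 := by linear_combination h₁ + h₂
  exact (mul_eq_zero.mp h2vw).resolve_left h2

theorem stmt19 (q m : ℕ) [Fact q.Prime] (hq : Odd q) (hm : 6 ≤ m) (hmeven : Even m)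
    (F : Type*) [Field F] [Fintype F] [DecidableEq F] [Algebra (ZMod q) F]
    (hF : Fintype.card F = q ^ m) :
    ∀ α β α' β' : F, grayCW q F α β ≠ 0 → grayCW q F α' β' ≠ 0 →
      Function.support (grayCW q F α' β') ⊆ Function.support (grayCW q F α β) →
      ∃ lam : ZMod q, lam ≠ 0 ∧ grayCW q F α' β' = fun j => lam * grayCW q F α β j := by
  intro α β α' β' _ hne' hsupp
  have hK : Fintype.card (ZMod q) % 2 = 1 := by rw [ZMod.card]; exact Nat.odd_iff.mp hq
  have h2 : (2 : ZMod q) ≠ 0 :=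
    Ring.two_ne_zero (by rw [ZMod.ringChar_zmod_n]; rintro rfl; exact absurd hq (by decide))
  have hrank : Module.finrank (ZMod q) F = m := by
    have hcard := Module.card_eq_pow_finrank (K := ZMod q) (V := F)
    rw [hF, ZMod.card] at hcard
    exact (Nat.pow_right_injective (Fact.out : q.Prime).two_le hcard).symm
  let B := Algebra.traceForm (ZMod q) F
  have hspan : ∀ u v : F, (∀ a, B a a = 0 → B u a = 0 → B v a = 0) →
      ∃ s : ZMod q, s • u = v := fun u v h =>
    Submodule.mem_span_singleton.mp <| mem_span_singleton_of_isotropic_orthogonal B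
      (traceForm_nondegenerate _ _) (Algebra.traceForm_isSymm _) hK h2 (by omega) h
  have himp : ∀ a b, B a a = 0 → B b b = 0 → B α a + B β b = 0 → B α' a + B β' b = 0 := by
    intro a b ha hb hab
    by_cases h0 : (a, b) = (0, 0)
    · simp only [Prod.mk.injEq] at h0
      simp [h0.1, h0.2]
    by_contra hne
    let j : DefIdx q F × Fin 2 := (⟨(a, b), h0, by simpa [B, Algebra.traceForm_apply, sq] using ha,
      by simpa [B, Algebra.traceForm_apply, sq] using hb⟩, 0)
    have hj : j ∈ Function.support (grayCW q F α' β') := by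
      simpa [j, grayCW, B, Algebra.traceForm_apply] using hne
    apply hsupp hj
    simpa [j, grayCW, B, Algebra.traceForm_apply] using hab
  obtain ⟨s, rfl⟩ := hspan α α' fun a ha h => by simpa using himp a 0 ha (by simp) (by simpa using h)
  obtain ⟨t, rfl⟩ := hspan β β' fun b hb h => by simpa using himp 0 b (by simp) hb (by simpa using h)
  have hex : ∀ u : F, u ≠ 0 → ∃ a, B a a = 0 ∧ B u a = 1 := by
    intro u hu
    by_contra! h
    refine hu ?_
    obtain ⟨r, hr⟩ := hspan 0 u fun a ha _ => by
      by_contra hua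
      exact h ((B u a)⁻¹ • a) (by simp [ha]) (by simp [hua])
    simpa using hr.symm
  obtain ⟨lam, hα, hβ⟩ : ∃ lam : ZMod q, s • α = lam • α ∧ t • β = lam • β := by
    by_cases hα : α = 0
    · exact ⟨t, by simp [hα], rfl⟩
    by_cases hβ : β = 0
    · exact ⟨s, rfl, by simp [hβ]⟩
    obtain ⟨a, ha, haα⟩ := hex α hα
    obtain ⟨b, hb, hbβ⟩ := hex β hβ
    have hst := himp a (-b) ha (by simpa using hb) (by simp [haα, hbβ])
    simp only [map_smul, map_neg, LinearMap.smul_apply, haα, hbβ, smul_eq_mul] at hst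
    have hts : t = s := by linear_combination -hst
    exact ⟨s, rfl, by rw [hts]⟩
  have hfun : grayCW q F (s • α) (t • β) = fun j => lam * grayCW q F α β j := by
    rw [hα, hβ]
    funext j
    simp only [grayCW, smul_mul_assoc, ← smul_add, map_smul, smul_eq_mul]
    split_ifs <;> rfl
  refine ⟨lam, ?_, hfun⟩
  rintro rfl
  exact hne' (by rw [hfun]; funext j; simp)
end
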